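/- arXiv:1504.00148 — 2 statements merged into one kernel-verified Lean document; each statement's English description precedes it below -/
import Mathlib

section
/- Let p ≥ 3 be a prime, r > 2p an integer with r ≡ a mod (p−1) where 2 ≤ a ≤ p−1. Write r = p^n·u with p ∤ u and suppose n > 0 (i.e., p | r) and Σ_p(u−1) = a−1. Then dim_{F_p} X_{r−1} = a + p + 2, and there is a short exact sequence of M-equivariant F_p-linear maps 0 → V_{p−a+1} ⊗ D^{a−1} → X_{r−1} → (V_{a−2} ⊗ D) ⊕ V_a → 0. -/
open MvPolynomial

/-- The action of a 2×2 matrix `g` over `F_p` on polynomials in two variables: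
`((a b; c d) · F)(X, Y) = F (aX + cY, bX + dY)`. -/
noncomputable def matAct (p : ℕ) (g : Matrix (Fin 2) (Fin 2) (ZMod p)) :
    MvPolynomial (Fin 2) (ZMod p) →ₐ[ZMod p] MvPolynomial (Fin 2) (ZMod p) :=
  aeval fun i => ∑ j, C (g j i) * X j

/-- The action of `g` twisted by the `n`-th power of the determinant character `D`. -/
noncomputable def twAct (p n : ℕ) (g : Matrix (Fin 2) (Fin 2) (ZMod p))
    (F : MvPolynomial (Fin 2) (ZMod p)) : MvPolynomial (Fin 2) (ZMod p) :=
  g.det ^ n • matAct p g F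

/-- `V_m`: homogeneous polynomials of degree `m` in two variables over `F_p`. -/
noncomputable def Vh (p m : ℕ) : Submodule (ZMod p) (MvPolynomial (Fin 2) (ZMod p)) :=
  homogeneousSubmodule (Fin 2) (ZMod p) m

/-- `X_r`: the `M`-submodule of `V_r` generated by `X^r`, realized as the span of the
orbit of `X^r` under the monoid `M = M_2(F_p)`. -/
noncomputable def XrSub (p r : ℕ) : Submodule (ZMod p) (MvPolynomial (Fin 2) (ZMod p)) :=
  Submodule.span (ZMod p)
    (Set.range fun g : Matrix (Fin 2) (Fin 2) (ZMod p) => matAct p g (X 0 ^ r))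

/-- `X_{r-1}`: the `M`-submodule of `V_r` generated by `X^{r-1} Y`. -/
noncomputable def Xr1Sub (p r : ℕ) : Submodule (ZMod p) (MvPolynomial (Fin 2) (ZMod p)) :=
  Submodule.span (ZMod p)
    (Set.range fun g : Matrix (Fin 2) (Fin 2) (ZMod p) => matAct p g (X 0 ^ (r - 1) * X 1))

/-- The special polynomial `θ = X^p Y − X Y^p`. -/
noncomputable def theta (p : ℕ) : MvPolynomial (Fin 2) (ZMod p) :=
  X 0 ^ p * X 1 - X 0 * X 1 ^ p

/-- `V_r^* = {F ∈ V_r : θ ∣ F}`. -/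
noncomputable def Vstar (p r : ℕ) : Submodule (ZMod p) (MvPolynomial (Fin 2) (ZMod p)) :=
  Vh p r ⊓ (Ideal.span {theta p}).restrictScalars (ZMod p)

/-- `V_r^{**} = {F ∈ V_r : θ² ∣ F}`. -/
noncomputable def Vdstar (p r : ℕ) : Submodule (ZMod p) (MvPolynomial (Fin 2) (ZMod p)) :=
  Vh p r ⊓ (Ideal.span {theta p ^ 2}).restrictScalars (ZMod p)

/-- `M`-equivariance of a linear map between two submodules of the polynomial ring,
where the source carries the action twisted by `D^{nA}` and the target by `D^{nB}`. -/
def EquivMap (p nA nB : ℕ)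
    {A B : Submodule (ZMod p) (MvPolynomial (Fin 2) (ZMod p))}
    (φ : A →ₗ[ZMod p] B) : Prop :=
  ∀ (g : Matrix (Fin 2) (Fin 2) (ZMod p)) (x y : A),
    (y : MvPolynomial (Fin 2) (ZMod p)) = twAct p nA g (x : MvPolynomial (Fin 2) (ZMod p)) →
    (φ y : MvPolynomial (Fin 2) (ZMod p)) = twAct p nB g (φ x : MvPolynomial (Fin 2) (ZMod p))

namespace Xr1

open Matrix Finset

section Basic

variable {p : ℕ}

/-- The linear form with coefficient vector `v`. -/
noncomputable def lin (v : Fin 2 → ZMod p) : MvPolynomial (Fin 2) (ZMod p) :=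
  ∑ j, C (v j) * X j

/-- The generator `v ^ N * w` attached to a pair of linear forms. -/
noncomputable def gen (N : ℕ) (v w : Fin 2 → ZMod p) : MvPolynomial (Fin 2) (ZMod p) :=
  lin v ^ N * lin w

/-- The pairing `v, w ↦ det (v, w)`. -/
def cross (v w : Fin 2 → ZMod p) : ZMod p := v 0 * w 1 - w 0 * v 1

/-- Rotation by a quarter turn. -/
def rot (v : Fin 2 → ZMod p) : Fin 2 → ZMod p := ![-v 1, v 0]

lemma lin_add (v w : Fin 2 → ZMod p) : lin (v + w) = lin v + lin w := by
  simp [lin, add_mul, sum_add_distrib]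

lemma lin_smul (c : ZMod p) (v : Fin 2 → ZMod p) : lin (c • v) = c • lin v := by
  simp [lin, smul_eq_C_mul, mul_assoc]

lemma gen_smul_right (N : ℕ) (c : ZMod p) (v w : Fin 2 → ZMod p) :
    gen N v (c • w) = c • gen N v w := by
  simp [gen, lin_smul]

lemma gen_add_right (N : ℕ) (v w w' : Fin 2 → ZMod p) :
    gen N v (w + w') = gen N v w + gen N v w' := by
  simp [gen, lin_add, mul_add]

lemma gen_smul_left (N : ℕ) (c : ZMod p) (v w : Fin 2 → ZMod p) :
    gen N (c • v) w = c ^ N • gen N v w := by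
  simp [gen, lin_smul, smul_pow]

lemma eval_lin (x v : Fin 2 → ZMod p) : eval x (lin v) = x ⬝ᵥ v := by
  simp [lin, dotProduct, mul_comm]

lemma eval_gen (N : ℕ) (x v w : Fin 2 → ZMod p) :
    eval x (gen N v w) = (x ⬝ᵥ v) ^ N * (x ⬝ᵥ w) := by
  simp [gen, eval_lin]

lemma isHomogeneous_lin (v : Fin 2 → ZMod p) : (lin v).IsHomogeneous 1 :=
  IsHomogeneous.sum _ _ _ fun i _ => isHomogeneous_C_mul_X _ i

lemma isHomogeneous_lin_pow (v : Fin 2 → ZMod p) (N : ℕ) : (lin v ^ N).IsHomogeneous N := by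
  simpa using (isHomogeneous_lin v).pow N

lemma isHomogeneous_gen (N : ℕ) (v w : Fin 2 → ZMod p) : (gen N v w).IsHomogeneous (N + 1) :=
  (isHomogeneous_lin_pow v N).mul (isHomogeneous_lin w)

lemma matAct_X (g : Matrix (Fin 2) (Fin 2) (ZMod p)) (i : Fin 2) :
    matAct p g (X i) = lin (gᵀ i) := by
  simp [matAct, lin]

lemma matAct_lin (g : Matrix (Fin 2) (Fin 2) (ZMod p)) (v : Fin 2 → ZMod p) :
    matAct p g (lin v) = lin (g *ᵥ v) := by
  simp [matAct, lin, mulVec, dotProduct, algebraMap_eq]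
  ring

lemma matAct_gen (g : Matrix (Fin 2) (Fin 2) (ZMod p)) (N : ℕ) (v w : Fin 2 → ZMod p) :
    matAct p g (gen N v w) = gen N (g *ᵥ v) (g *ᵥ w) := by
  simp [gen, matAct_lin]

lemma matAct_generator (g : Matrix (Fin 2) (Fin 2) (ZMod p)) (N : ℕ) :
    matAct p g (X 0 ^ N * X 1) = gen N (gᵀ 0) (gᵀ 1) := by
  simp [gen, matAct_X]

lemma det_eq_cross (g : Matrix (Fin 2) (Fin 2) (ZMod p)) : g.det = cross (gᵀ 0) (gᵀ 1) := by
  simp [det_fin_two, cross]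

lemma cross_mulVec (g : Matrix (Fin 2) (Fin 2) (ZMod p)) (v w : Fin 2 → ZMod p) :
    cross (g *ᵥ v) (g *ᵥ w) = g.det * cross v w := by
  simp [cross, det_fin_two, mulVec, dotProduct]
  ring

lemma eval_matAct (g : Matrix (Fin 2) (Fin 2) (ZMod p)) (x : Fin 2 → ZMod p)
    (F : MvPolynomial (Fin 2) (ZMod p)) : eval x (matAct p g F) = eval (x ᵥ* g) F := by
  induction F using MvPolynomial.induction_on with
  | C c => simp [matAct, algebraMap_eq]
  | add F G hF hG => simp [hF, hG]
  | mul_X F i hF =>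
    rw [map_mul, map_mul, map_mul, hF, matAct_X, eval_lin, eval_X]
    rfl

lemma isHomogeneous_matAct (g : Matrix (Fin 2) (Fin 2) (ZMod p)) {m : ℕ}
    {F : MvPolynomial (Fin 2) (ZMod p)} (hF : F.IsHomogeneous m) :
    (matAct p g F).IsHomogeneous m := by
  have := hF.aeval (n := 1) (fun i => ∑ j, C (g j i) * X j) fun i =>
    IsHomogeneous.sum _ _ _ fun j _ => isHomogeneous_C_mul_X _ j
  rwa [one_mul] at this

/-- The gradient of `F` at the point `x`. -/
noncomputable def grad (F : MvPolynomial (Fin 2) (ZMod p)) (x : Fin 2 → ZMod p) :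
    Fin 2 → ZMod p := fun i => eval x (pderiv i F)

lemma pderiv_lin (i : Fin 2) (v : Fin 2 → ZMod p) : pderiv i (lin v) = C (v i) := by
  fin_cases i <;> simp [lin]

lemma pderiv_matAct (g : Matrix (Fin 2) (Fin 2) (ZMod p)) (i : Fin 2)
    (F : MvPolynomial (Fin 2) (ZMod p)) :
    pderiv i (matAct p g F) = ∑ j, C (g i j) * matAct p g (pderiv j F) := by
  induction F using MvPolynomial.induction_on with
  | C c => simp [matAct, algebraMap_eq]
  | add F G hF hG => simp [hF, hG, mul_add]; ring
  | mul_X F k hF =>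
    rw [map_mul, Derivation.leibniz, hF, matAct_X, pderiv_lin]
    fin_cases k <;> simp [pderiv_X, matAct_X] <;> ring

lemma grad_matAct (g : Matrix (Fin 2) (Fin 2) (ZMod p)) (x : Fin 2 → ZMod p)
    (F : MvPolynomial (Fin 2) (ZMod p)) : grad (matAct p g F) x = g *ᵥ grad F (x ᵥ* g) := by
  ext i
  simp [grad, pderiv_matAct, eval_matAct, mulVec, dotProduct]

lemma eval_smul_of_isHomogeneous {m : ℕ} {F : MvPolynomial (Fin 2) (ZMod p)}
    (hF : F.IsHomogeneous m) (c : ZMod p) (x : Fin 2 → ZMod p) :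
    eval (c • x) F = c ^ m * eval x F := by
  rw [eval_eq, eval_eq, mul_sum]
  refine sum_congr rfl fun d hd => ?_
  have : ∑ i ∈ d.support, d i = m := by
    rw [← hF (mem_support_iff.mp hd), Finsupp.weight_apply]
    simp [Finsupp.sum]
  simp only [Pi.smul_apply, smul_eq_mul, mul_pow, prod_mul_distrib, prod_pow_eq_pow_sum, this]
  ring

lemma grad_smul {m : ℕ} {F : MvPolynomial (Fin 2) (ZMod p)}
    (hF : F.IsHomogeneous m) (c : ZMod p) (x : Fin 2 → ZMod p) :
    grad F (c • x) = c ^ (m - 1) • grad F x := by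
  ext i
  simp [grad, eval_smul_of_isHomogeneous hF.pderiv]

lemma cross_grad_rot {m : ℕ} {F : MvPolynomial (Fin 2) (ZMod p)}
    (hF : F.IsHomogeneous m) (v : Fin 2 → ZMod p) :
    cross v (grad F (rot v)) = m * eval (rot v) F := by
  have h := congrArg (eval (rot v)) hF.sum_X_mul_pderiv
  simp [Fin.sum_univ_two, rot] at h
  simp only [cross, grad, rot]
  linear_combination h

lemma rot_mulVec_vecMul (g : Matrix (Fin 2) (Fin 2) (ZMod p)) (v : Fin 2 → ZMod p) :
    rot (g *ᵥ v) ᵥ* g = g.det • rot v := by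
  ext i
  fin_cases i <;> simp [rot, vecMul, mulVec, dotProduct, det_fin_two] <;> ring

lemma exists_vecMulVec_of_det_eq_zero [Fact p.Prime] {g : Matrix (Fin 2) (Fin 2) (ZMod p)}
    (hg : g.det = 0) : ∃ l k : Fin 2 → ZMod p, g = vecMulVec l k := by
  obtain ⟨x, hx, h⟩ := exists_vecMul_eq_zero_iff.mpr hg
  have h0 : ∀ j, x 0 * g 0 j + x 1 * g 1 j = 0 := fun j => by
    simpa [vecMul, dotProduct] using congrFun h j
  by_cases hx0 : x 0 = 0
  · have hx1 : x 1 ≠ 0 := fun h1 => hx (by ext i; fin_cases i <;> simp [hx0, h1])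
    refine ⟨![1, 0], g 0, ?_⟩
    ext i j
    have := h0 j
    fin_cases i <;> simp_all [vecMulVec]
  · refine ⟨![-(x 1 / x 0), 1], g 1, ?_⟩
    ext i j
    fin_cases i
    · simp only [vecMulVec, of_apply, Fin.zero_eta, cons_val_zero]
      field_simp
      linear_combination h0 j
    · simp [vecMulVec]

end Basic

section Sums

variable {p : ℕ} [hp : Fact p.Prime]

lemma pow_eq_pow_of_modEq {i j : ℕ} (h : i ≡ j [MOD p - 1]) (hi : i ≠ 0) (hj : j ≠ 0)
    (x : ZMod p) : x ^ i = x ^ j := by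
  rcases eq_or_ne x 0 with rfl | hx
  · simp [hi, hj]
  · have key : ∀ k, x ^ k = x ^ (k % (p - 1)) := fun k => by
      conv_lhs => rw [← Nat.div_add_mod k (p - 1), pow_add, pow_mul,
        ZMod.pow_card_sub_one_eq_one hx, one_pow, one_mul]
    rw [key i, key j, h]

lemma sum_pow_eq_zero {i : ℕ} (h : i = 0 ∨ ¬ (p - 1) ∣ i) : ∑ x : ZMod p, x ^ i = 0 := by
  rcases h with rfl | h
  · simp
  · have h1 : i % (p - 1) ≠ 0 := fun h' => h (Nat.dvd_of_mod_eq_zero h')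
    have h2 : i ≠ 0 := fun h' => h (h' ▸ dvd_zero _)
    have hp1 : 0 < p - 1 := Nat.sub_pos_of_lt hp.out.one_lt
    rw [← FiniteField.sum_pow_lt_card_sub_one (ZMod p) (i % (p - 1))
      (by rw [ZMod.card]; exact Nat.mod_lt _ hp1)]
    exact sum_congr rfl fun x _ => pow_eq_pow_of_modEq (Nat.mod_modEq _ _).symm h2 h1 x

lemma sum_pow_eq_neg_one {i : ℕ} (h0 : i ≠ 0) (h : (p - 1) ∣ i) :
    ∑ x : ZMod p, x ^ i = -1 := by
  have hp1 : p - 1 ≠ 0 := (Nat.sub_pos_of_lt hp.out.one_lt).ne'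
  have : ∀ x : ZMod p, x ^ i = 1 - if x = 0 then 1 else 0 := fun x => by
    rw [pow_eq_pow_of_modEq (j := p - 1)
      (((Nat.modEq_zero_iff_dvd).mpr h).trans
        ((Nat.modEq_zero_iff_dvd).mpr dvd_rfl).symm) h0 hp1]
    split_ifs with hx
    · simp [hx, hp1]
    · simp [ZMod.pow_card_sub_one_eq_one hx]
  simp [this]

lemma rot_eq_vecMul (v : Fin 2 → ZMod p) : rot v = v ᵥ* !![0, 1; -1, 0] := by
  ext i
  fin_cases i <;> simp [rot, vecMul, dotProduct]

lemma sum_eval_eq_zero_of_isHomogeneous {d : ℕ} {F : MvPolynomial (Fin 2) (ZMod p)}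
    (hF : F.IsHomogeneous d) (hd : d < 2 * (p - 1)) : ∑ v, eval v F = 0 := by
  refine MvPolynomial.sum_eval_eq_zero F (hF.totalDegree_le.trans_lt ?_)
  rw [ZMod.card, Fintype.card_fin]
  omega

lemma sum_dotProduct_pow_mul_eval_rot {m s : ℕ} {F : MvPolynomial (Fin 2) (ZMod p)}
    (hF : F.IsHomogeneous m) (hd : s + m < 2 * (p - 1)) (k : Fin 2 → ZMod p) :
    ∑ v, (k ⬝ᵥ v) ^ s * eval (rot v) F = 0 := by
  rw [← sum_eval_eq_zero_of_isHomogeneous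
    ((isHomogeneous_lin_pow k s).mul (isHomogeneous_matAct !![0, 1; -1, 0] hF)) hd]
  refine sum_congr rfl fun v _ => ?_
  rw [map_mul, map_pow, eval_lin, eval_matAct, rot_eq_vecMul, dotProduct_comm]

lemma sum_dotProduct_pow_mul_grad_rot {m s N : ℕ} {F : MvPolynomial (Fin 2) (ZMod p)}
    (hF : F.IsHomogeneous m) (hd : s + (m - 1) < 2 * (p - 1)) (hs : s ≠ 0) (hN : N ≠ 0)
    (hNs : N ≡ s [MOD p - 1]) (k : Fin 2 → ZMod p) :
    ∑ v, (k ⬝ᵥ v) ^ N * (k ⬝ᵥ grad F (rot v)) = 0 := by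
  simp only [pow_eq_pow_of_modEq hNs hN hs]
  have := fun i => sum_dotProduct_pow_mul_eval_rot (hF.pderiv (i := i)) hd k
  calc _ = ∑ i, k i * ∑ v, (k ⬝ᵥ v) ^ s * eval (rot v) (pderiv i F) := by
        simp only [mul_sum, Fin.sum_univ_two, ← sum_add_distrib]
        refine sum_congr rfl fun v _ => ?_
        simp [dotProduct, grad]
        ring
    _ = 0 := by simp only [this, mul_zero, sum_const_zero]

lemma eq_zero_of_forall_eval {m : ℕ} {F : MvPolynomial (Fin 2) (ZMod p)}
    (hF : F.IsHomogeneous m) (hm : m ≤ p) (h : ∀ x, eval x F = 0) : F = 0 :=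
  hF.eq_zero_of_forall_eval_eq_zero_of_le_card h (by simpa [Cardinal.mk_fintype] using hm)

end Sums

section Coefficients

variable {p : ℕ}

/-- The exponent of the monomial `X ^ i * Y ^ j`. -/
noncomputable def mon (i j : ℕ) : Fin 2 →₀ ℕ := Finsupp.single 0 i + Finsupp.single 1 j

lemma mon_apply_zero (i j : ℕ) : mon i j 0 = i := by simp [mon]

lemma mon_apply_one (i j : ℕ) : mon i j 1 = j := by simp [mon]

lemma mon_inj {i j i' j' : ℕ} : mon i j = mon i' j' ↔ i = i' ∧ j = j' := by
  refine ⟨fun h => ?_, fun h => by rw [h.1, h.2]⟩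
  have h0 := DFunLike.congr_fun h 0
  have h1 := DFunLike.congr_fun h 1
  simp only [mon_apply_zero, mon_apply_one] at h0 h1
  exact ⟨h0, h1⟩

lemma eq_mon (d : Fin 2 →₀ ℕ) : d = mon (d 0) (d 1) := by
  ext i
  fin_cases i <;> simp [mon]

lemma degree_mon (i j : ℕ) : (mon i j).degree = i + j := by
  simp [mon]

lemma monomial_mon {R : Type*} [CommSemiring R] (i j : ℕ) (c : R) :
    monomial (mon i j) c = C c * (X 0 ^ i * X 1 ^ j) := by
  rw [X_pow_eq_monomial, X_pow_eq_monomial, monomial_mul, C_mul_monomial]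
  simp [mon]

lemma isHomogeneous_monomial_mon {R : Type*} [CommSemiring R] {m i j : ℕ} (h : i + j = m)
    (c : R) :
    (monomial (mon i j) c).IsHomogeneous m :=
  isHomogeneous_monomial c (by rw [degree_mon, h])

lemma eq_of_coeff_mon {R : Type*} [CommSemiring R] {m : ℕ} {F G : MvPolynomial (Fin 2) R}
    (hF : F.IsHomogeneous m) (hG : G.IsHomogeneous m)
    (h : ∀ k ≤ m, coeff (mon (m - k) k) F = coeff (mon (m - k) k) G) : F = G := by
  ext d
  by_cases hd : d.degree = m
  · have hd' : d 0 + d 1 = m := by rw [← hd, eq_mon d, degree_mon, mon_apply_zero, mon_apply_one]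
    have := h (d 1) (by omega)
    rwa [show m - d 1 = d 0 by omega, ← eq_mon] at this
  · rw [hF.coeff_eq_zero hd, hG.coeff_eq_zero hd]

lemma eq_sum_monomial_mon {R : Type*} [CommSemiring R] {m : ℕ} {F : MvPolynomial (Fin 2) R}
    (hF : F.IsHomogeneous m) :
    F = ∑ k ∈ range (m + 1), monomial (mon (m - k) k) (coeff (mon (m - k) k) F) := by
  refine eq_of_coeff_mon hF (IsHomogeneous.sum _ _ _ fun k hk =>
    isHomogeneous_monomial_mon (by have := mem_range.mp hk; omega) _) fun k hk => ?_
  rw [coeff_sum, sum_eq_single k]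
  · simp
  · intro j _ hj
    rw [coeff_monomial, if_neg fun h => hj (mon_inj.mp h).2]
  · intro h
    exact absurd (mem_range.mpr (by omega)) h

lemma mem_Vh {m : ℕ} {F : MvPolynomial (Fin 2) (ZMod p)} : F ∈ Vh p m ↔ F.IsHomogeneous m :=
  Iff.rfl

lemma Vh_eq_span (m : ℕ) : Vh p m = Submodule.span (ZMod p)
    (Set.range fun k : Fin (m + 1) => monomial (mon (m - k) k) (1 : ZMod p)) := by
  refine le_antisymm (fun F hF => ?_) (Submodule.span_le.mpr ?_)
  · rw [eq_sum_monomial_mon hF]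
    refine Submodule.sum_mem _ fun k hk => ?_
    rw [← mul_one (coeff _ F), ← smul_eq_mul, ← smul_monomial]
    exact Submodule.smul_mem _ _ (Submodule.subset_span ⟨⟨k, mem_range.mp hk⟩, rfl⟩)
  · rintro _ ⟨k, rfl⟩
    exact isHomogeneous_monomial_mon (by have := k.2; omega) _

lemma finrank_Vh [Fact p.Prime] (m : ℕ) : Module.finrank (ZMod p) (Vh p m) = m + 1 := by
  rw [Vh_eq_span, finrank_span_eq_card, Fintype.card_fin]
  refine (basisMonomials (Fin 2) (ZMod p)).linearIndependent.comp
    (fun k : Fin (m + 1) => mon (m - k) k) fun i j h => ?_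
  exact Fin.ext (mon_inj.mp h).2

instance finite_Vh [Fact p.Prime] (m : ℕ) : Module.Finite (ZMod p) (Vh p m) :=
  Module.finite_of_finrank_pos (by rw [finrank_Vh]; omega)

lemma lin_eq (v : Fin 2 → ZMod p) : lin v = C (v 0) * X 0 + C (v 1) * X 1 := by
  simp [lin]

lemma lin_pow_eq_sum (v : Fin 2 → ZMod p) (N : ℕ) :
    lin v ^ N = ∑ k ∈ range (N + 1),
      monomial (mon k (N - k)) (v 0 ^ k * v 1 ^ (N - k) * N.choose k) := by
  rw [lin_eq, add_pow]
  refine sum_congr rfl fun k _ => ?_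
  rw [monomial_mon]
  simp only [map_mul, map_pow, map_natCast]
  ring

lemma coeff_lin_pow (v : Fin 2 → ZMod p) {N i j : ℕ} (h : i + j = N) :
    coeff (mon i j) (lin v ^ N) = N.choose i * v 0 ^ i * v 1 ^ j := by
  rw [lin_pow_eq_sum, coeff_sum, sum_eq_single i]
  · rw [show N - i = j by omega]
    simp
    ring
  · intro k _ hk
    rw [coeff_monomial, if_neg fun h => hk (mon_inj.mp h).1]
  · intro h'
    exact absurd (mem_range.mpr (by omega)) h'

lemma coeff_gen (v w : Fin 2 → ZMod p) {N i j : ℕ} (h : i + j + 1 = N) :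
    coeff (mon (i + 1) (j + 1)) (gen N v w) =
      N.choose (i + 1) * v 0 ^ (i + 1) * v 1 ^ j * w 1 +
      N.choose i * v 0 ^ i * v 1 ^ (j + 1) * w 0 := by
  have h0 : mon (i + 1) (j + 1) = mon i (j + 1) + Finsupp.single 0 1 := by
    rw [mon, mon, Finsupp.single_add]; abel
  have h1 : mon (i + 1) (j + 1) = mon (i + 1) j + Finsupp.single 1 1 := by
    rw [mon, mon, Finsupp.single_add 1]; abel
  have : gen N v w = C (w 0) * (lin v ^ N * X 0) + C (w 1) * (lin v ^ N * X 1) := by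
    rw [gen, lin_eq w]; ring
  rw [this, coeff_add, coeff_C_mul, coeff_C_mul, h0, coeff_mul_X, ← h0, h1, coeff_mul_X,
    coeff_lin_pow v (by omega), coeff_lin_pow v (by omega)]
  ring

lemma cast_choose_ne_zero [hp : Fact p.Prime] {m k : ℕ} (hm : m < p) (hk : k ≤ m) :
    (m.choose k : ZMod p) ≠ 0 := by
  rw [Ne, ZMod.natCast_eq_zero_iff]
  intro h
  have := hp.out.dvd_factorial.mp
    (h.trans (Dvd.intro _ ((mul_assoc _ _ _).symm.trans (Nat.choose_mul_factorial_mul_factorial hk))))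
  omega

/-- In degree `m < p` the powers of linear forms span all forms. -/
lemma Vh_le_span_lin_pow [hp : Fact p.Prime] {m : ℕ} (hm : m < p) :
    Vh p m ≤ Submodule.span (ZMod p) (Set.range fun v : Fin 2 → ZMod p => lin v ^ m) := by
  rw [Vh_eq_span, Submodule.span_le]
  rintro _ ⟨⟨k, hk⟩, rfl⟩
  rcases Nat.eq_zero_or_pos k with rfl | hk0
  · refine Submodule.subset_span ⟨![1, 0], ?_⟩
    simp [lin, monomial_mon]
  have hkm : k ≤ m := by omega
  have hc := cast_choose_ne_zero hm (m.sub_le k)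
  have key : monomial (mon (m - k) k) (1 : ZMod p) =
      (-(m.choose (m - k) : ZMod p)⁻¹) • ∑ t : ZMod p, t ^ (p - 1 - k) • lin ![1, t] ^ m := by
    refine eq_of_coeff_mon (isHomogeneous_monomial_mon (Nat.sub_add_cancel hkm) _) ?_ fun i hi => ?_
    · exact Submodule.smul_mem (Vh p m) _ (Submodule.sum_mem _ fun t _ =>
        Submodule.smul_mem _ _ (isHomogeneous_lin_pow _ _))
    have hsum : coeff (mon (m - i) i) (∑ t : ZMod p, t ^ (p - 1 - k) • lin ![1, t] ^ m) =
        m.choose (m - i) * ∑ t : ZMod p, t ^ (p - 1 - k + i) := by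
      rw [coeff_sum, mul_sum]
      refine sum_congr rfl fun t _ => ?_
      rw [coeff_smul, coeff_lin_pow _ (by omega)]
      simp [pow_add]
      ring
    rw [coeff_smul, hsum, coeff_monomial]
    have hp2 := hp.out.two_le
    split_ifs with h
    · obtain rfl := (mon_inj.mp h).2
      rw [sum_pow_eq_neg_one (by omega) (by rw [show p - 1 - k + k = p - 1 by omega])]
      simp [hc]
    · have hik : i ≠ k := fun h' => h (by rw [h'])
      rw [sum_pow_eq_zero, mul_zero, smul_zero]
      rcases lt_or_gt_of_ne hik with h | h
      · rcases Nat.eq_zero_or_pos (p - 1 - k + i) with h' | h'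
        · exact Or.inl h'
        · exact Or.inr (Nat.not_dvd_of_pos_of_lt h' (by omega))
      · rw [show p - 1 - k + i = (p - 1) + (i - k) by omega, Nat.dvd_add_right dvd_rfl]
        exact Or.inr (Nat.not_dvd_of_pos_of_lt (by omega) (by omega))
  simp only [key]
  exact Submodule.smul_mem _ _ (Submodule.sum_mem _ fun t _ =>
    Submodule.smul_mem _ _ (Submodule.subset_span ⟨_, rfl⟩))

end Coefficients

lemma exists_linearMap_span {K V W ι : Type*} [Field K] [AddCommGroup V] [Module K V]
    [AddCommGroup W] [Module K W] [Fintype ι] (f : ι → V) (g : ι → W)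
    (h : ∀ c : ι → K, ∑ i, c i • f i = 0 → ∑ i, c i • g i = 0) :
    ∃ φ : Submodule.span K (Set.range f) →ₗ[K] W, ∀ i hi, φ ⟨f i, hi⟩ = g i := by
  classical
  obtain ⟨s, hs⟩ := (Fintype.linearCombination K f).rangeRestrict.exists_rightInverse_of_surjective
    (LinearMap.range_rangeRestrict _)
  have hspan := Fintype.range_linearCombination K f
  refine ⟨Fintype.linearCombination K g ∘ₗ s ∘ₗ (LinearEquiv.ofEq _ _ hspan.symm).toLinearMap,
    fun i hi => ?_⟩
  have hi' : f i ∈ LinearMap.range (Fintype.linearCombination K f) := hspan ▸ hi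
  have h1 : Fintype.linearCombination K f (s ⟨f i, hi'⟩) = f i := by
    have := congrArg Subtype.val (LinearMap.congr_fun hs ⟨f i, hi'⟩)
    exact this
  have h2 : Fintype.linearCombination K f (s ⟨f i, hi'⟩ - Pi.single i 1) = 0 := by
    rw [map_sub, h1, Fintype.linearCombination_apply_single, one_smul, sub_self]
  have h3 : Fintype.linearCombination K g (s ⟨f i, hi'⟩ - Pi.single i 1) = 0 := h _ h2
  rw [map_sub, Fintype.linearCombination_apply_single, one_smul, sub_eq_zero] at h3
  exact h3

section Relations

variable {p : ℕ} [hp : Fact p.Prime] {ι : Type*} [Fintype ι]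

lemma sum_gen_eq_zero {N s : ℕ} (hs : s ≠ 0) (hN : N ≠ 0) (hNs : N ≡ s [MOD p - 1])
    (hsp : s + 1 ≤ p) {c : ι → ZMod p} {v w : ι → Fin 2 → ZMod p}
    (h : ∑ i, c i • gen N (v i) (w i) = 0) : ∑ i, c i • gen s (v i) (w i) = 0 := by
  refine eq_zero_of_forall_eval (m := s + 1) ?_ hsp fun x => ?_
  · exact Submodule.sum_mem (Vh p (s + 1)) fun i _ =>
      Submodule.smul_mem _ _ (isHomogeneous_gen _ _ _)
  · rw [← map_zero (eval x), ← h]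
    simp only [map_sum, smul_eval, eval_gen, pow_eq_pow_of_modEq hNs hN hs]

lemma pderiv_gen {r : ℕ} (hr : (r : ZMod p) = 0) (hr2 : 2 ≤ r) (v w : Fin 2 → ZMod p) :
    pderiv 0 (gen (r - 1) v w) = -(cross v w • (X 1 * lin v ^ (r - 2))) := by
  obtain ⟨k, rfl⟩ := Nat.exists_eq_add_of_le' hr2
  have hk : (C ((k : ZMod p)) : MvPolynomial (Fin 2) (ZMod p)) = -2 := by
    rw [← map_ofNat C 2, ← map_neg]
    push_cast at hr
    rw [eq_neg_of_add_eq_zero_left hr]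
  rw [gen, Derivation.leibniz, Derivation.leibniz_pow, pderiv_lin, pderiv_lin]
  simp only [show k + 2 - 1 = k + 1 by omega, Nat.add_sub_cancel, smul_eq_mul, nsmul_eq_mul,
    smul_eq_C_mul, cross, map_sub, map_mul]
  rw [lin_eq w]
  rw [map_natCast] at hk
  push_cast
  rw [hk, pow_succ, ← sub_eq_zero]
  generalize lin v ^ k = L
  rw [lin_eq v]
  ring

lemma sum_cross_lin_pow_eq_zero {r : ℕ} (hr : (r : ZMod p) = 0) (hr2 : 2 ≤ r)
    {c : ι → ZMod p} {v w : ι → Fin 2 → ZMod p}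
    (h : ∑ i, c i • gen (r - 1) (v i) (w i) = 0) :
    ∑ i, (c i * cross (v i) (w i)) • lin (v i) ^ (r - 2) = 0 := by
  have h1 := congrArg (pderiv 0) h
  simp only [map_sum, Derivation.map_smul, pderiv_gen hr hr2, map_zero] at h1
  have h2 : X 1 * ∑ i, (c i * cross (v i) (w i)) • lin (v i) ^ (r - 2) =
      -∑ i, c i • -(cross (v i) (w i) • (X 1 * lin (v i) ^ (r - 2))) := by
    rw [mul_sum, ← sum_neg_distrib]
    refine sum_congr rfl fun i _ => ?_
    rw [smul_neg, neg_neg, mul_smul, mul_smul_comm, mul_smul_comm]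
  rw [h1, neg_zero] at h2
  exact (mul_eq_zero.mp h2).resolve_left (X_ne_zero 1)

lemma cast_choose_pred_self {q : ℕ} (hq : 0 < q) :
    ((p * q - 1).choose (p - 1) : ZMod p) = 1 := by
  have hp2 := hp.out.two_le
  obtain ⟨k, rfl⟩ := Nat.exists_eq_add_of_le' hq
  have h : p * (k + 1) - 1 = (p - 1) + p * k := by rw [mul_add]; omega
  have := (ZMod.natCast_eq_natCast_iff _ _ _).mpr
    (Choose.choose_modEq_choose_mod_mul_choose_div_nat (n := p * (k + 1) - 1) (k := p - 1) (p := p))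
  rw [this, h, Nat.add_mul_mod_self_left, Nat.mod_eq_of_lt (by omega : p - 1 < p),
    Nat.div_eq_of_lt (by omega : p - 1 < p)]
  simp

lemma cast_choose_pred_prime {q : ℕ} (hq : 0 < q) :
    ((p * q - 1).choose p : ZMod p) = q - 1 := by
  have hp2 := hp.out.two_le
  obtain ⟨k, rfl⟩ := Nat.exists_eq_add_of_le' hq
  have h : p * (k + 1) - 1 = (p - 1) + p * k := by rw [mul_add]; omega
  have := (ZMod.natCast_eq_natCast_iff _ _ _).mpr
    (Choose.choose_modEq_choose_mod_mul_choose_div_nat (n := p * (k + 1) - 1) (k := p) (p := p))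
  rw [this, h, Nat.add_mul_div_left _ _ hp.out.pos, Nat.div_eq_of_lt (by omega : p - 1 < p),
    Nat.mod_self, Nat.div_self hp.out.pos]
  simp

lemma cast_choose_sub_two_ne_zero {q i : ℕ} (hq : 0 < q) (hi : i ≤ p - 2) :
    ((p * q - 2).choose i : ZMod p) ≠ 0 := by
  have hp2 := hp.out.two_le
  obtain ⟨k, rfl⟩ := Nat.exists_eq_add_of_le' hq
  have h : p * (k + 1) - 2 = (p - 2) + p * k := by rw [mul_add]; omega
  have := (ZMod.natCast_eq_natCast_iff _ _ _).mpr
    (Choose.choose_modEq_choose_mod_mul_choose_div_nat (n := p * (k + 1) - 2) (k := i) (p := p))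
  rw [this, h, Nat.add_mul_mod_self_left, Nat.mod_eq_of_lt (by omega : p - 2 < p),
    Nat.div_eq_of_lt (by omega : i < p), Nat.mod_eq_of_lt (by omega : i < p)]
  simpa using cast_choose_ne_zero (by omega) hi

/-- In weight `2` the pairing `cross v w` is a linear functional of `v ^ (r - 1) * w`. -/
lemma sum_cross_eq_zero {q : ℕ} (hq : 2 < q) (hq2 : (q : ZMod p) ≠ 2)
    (hmod : p * q ≡ 2 [MOD p - 1]) {c : ι → ZMod p} {v w : ι → Fin 2 → ZMod p}
    (h : ∑ i, c i • gen (p * q - 1) (v i) (w i) = 0) :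
    ∑ i, c i * cross (v i) (w i) = 0 := by
  have hp2 := hp.out.two_le
  have hr : 2 * p < p * q := by nlinarith
  set r := p * q with hrq
  have hr0 : (r : ZMod p) = 0 := by simp [hrq]
  have hr1 : ((r - 1 : ℕ) : ZMod p) = -1 := by
    rw [Nat.cast_sub (by omega), hr0]; simp
  have hmod2 : r - 2 ≡ 0 [MOD p - 1] :=
    (Nat.ModEq.add_right_cancel' 2 (by rwa [zero_add, Nat.sub_add_cancel (by omega)]))
  have hp1 : p - 1 ≡ 0 [MOD p - 1] := (Nat.modEq_zero_iff_dvd).mpr dvd_rfl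
  have e1 : ∀ x : ZMod p, x ^ (r - 2) = x ^ (p - 1) :=
    pow_eq_pow_of_modEq (hmod2.trans hp1.symm) (by omega) (by omega)
  have e2 : ∀ x : ZMod p, x ^ (r - 1) = x := fun x => by
    rw [show r - 1 = r - 2 + 1 by omega, pow_succ, e1, ← pow_succ, Nat.sub_add_cancel (by omega),
      ZMod.pow_card]
  have e3 : ∀ x : ZMod p, x ^ (r - p - 1) = x ^ (p - 1) := by
    refine pow_eq_pow_of_modEq (Nat.ModEq.add_right_cancel' (p - 1) ?_) (by omega) (by omega)
    rw [show r - p - 1 + (p - 1) = r - 2 by omega]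
    exact hmod2.trans (hp1.add hp1).symm
  have e4 : ∀ x : ZMod p, x ^ (r - p) = x := fun x => by
    rw [show r - p = r - p - 1 + 1 by omega, pow_succ, e3, ← pow_succ, Nat.sub_add_cancel (by omega),
      ZMod.pow_card]
  have c1 : ((r - 1).choose (r - p - 1) : ZMod p) = q - 1 := by
    rw [← cast_choose_pred_prime (p := p) (by omega : 0 < q), ← hrq]
    congr 1
    exact Nat.choose_symm_of_eq_add (by omega)
  have c2 : ((r - 1).choose (r - p) : ZMod p) = 1 := by
    rw [← cast_choose_pred_self (p := p) (by omega : 0 < q), ← hrq]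
    congr 1
    exact Nat.choose_symm_of_eq_add (by omega)
  have c3 := cast_choose_pred_self (p := p) (by omega : 0 < q)
  have c4 := cast_choose_pred_prime (p := p) (by omega : 0 < q)
  rw [← hrq] at c3 c4
  have kA : ∀ v w : Fin 2 → ZMod p, coeff (mon (r - 1) 1) (gen (r - 1) v w) =
      v 0 * w 1 - v 0 ^ (p - 1) * v 1 * w 0 := fun v w => by
    have := coeff_gen v w (N := r - 1) (i := r - 2) (j := 0) (by omega)
    rw [show r - 2 + 1 = r - 1 by omega, zero_add] at this
    rw [this, Nat.choose_self, show (r - 1).choose (r - 2) = r - 1 by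
      rw [Nat.choose_symm_of_eq_add (by omega : r - 1 = (r - 2) + 1), Nat.choose_one_right],
      hr1, e1, e2]
    simp
    ring
  have kA' : ∀ v w : Fin 2 → ZMod p, coeff (mon 1 (r - 1)) (gen (r - 1) v w) =
      v 1 * w 0 - v 1 ^ (p - 1) * v 0 * w 1 := fun v w => by
    have := coeff_gen v w (N := r - 1) (i := 0) (j := r - 2) (by omega)
    rw [show r - 2 + 1 = r - 1 by omega, zero_add] at this
    rw [this, Nat.choose_one_right, hr1, e1, e2]
    simp
    ring
  have kB : ∀ v w : Fin 2 → ZMod p, coeff (mon p (r - p)) (gen (r - 1) v w) =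
      (q - 1) * v 0 * v 1 ^ (p - 1) * w 1 + v 0 ^ (p - 1) * v 1 * w 0 := fun v w => by
    have := coeff_gen v w (N := r - 1) (i := p - 1) (j := r - p - 1) (by omega)
    rw [show r - p - 1 + 1 = r - p by omega, Nat.sub_add_cancel (by omega)] at this
    rw [this, c3, c4, e3, e4, ZMod.pow_card]
    ring
  have kB' : ∀ v w : Fin 2 → ZMod p, coeff (mon (r - p) p) (gen (r - 1) v w) =
      (q - 1) * v 1 * v 0 ^ (p - 1) * w 0 + v 1 ^ (p - 1) * v 0 * w 1 := fun v w => by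
    have := coeff_gen v w (N := r - 1) (i := r - p - 1) (j := p - 1) (by omega)
    rw [show r - p - 1 + 1 = r - p by omega, Nat.sub_add_cancel (by omega)] at this
    rw [this, c1, c2, e3, e4, ZMod.pow_card]
    ring
  have hq2' : (q - 2 : ZMod p) ≠ 0 := sub_ne_zero.mpr hq2
  have key : ∀ v w : Fin 2 → ZMod p, (q - 2) * cross v w =
      (q - 2) * (coeff (mon (r - 1) 1) (gen (r - 1) v w) -
        coeff (mon 1 (r - 1)) (gen (r - 1) v w)) -
      (coeff (mon p (r - p)) (gen (r - 1) v w) -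
        coeff (mon (r - p) p) (gen (r - 1) v w)) := fun v w => by
    rw [kA, kA', kB, kB', cross]
    ring
  have hcoeff : ∀ d, ∑ i, c i * coeff d (gen (r - 1) (v i) (w i)) = 0 := fun d => by
    have := congrArg (coeff d) h
    simpa [coeff_sum] using this
  refine (mul_eq_zero.mp ?_).resolve_left hq2'
  calc _ = (q - 2) * (∑ i, c i * coeff (mon (r - 1) 1) (gen (r - 1) (v i) (w i)) -
        ∑ i, c i * coeff (mon 1 (r - 1)) (gen (r - 1) (v i) (w i))) -
      (∑ i, c i * coeff (mon p (r - p)) (gen (r - 1) (v i) (w i)) -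
        ∑ i, c i * coeff (mon (r - p) p) (gen (r - 1) (v i) (w i))) := by
        rw [mul_sum, ← sum_sub_distrib, ← sum_sub_distrib, mul_sum, ← sum_sub_distrib]
        refine sum_congr rfl fun i _ => ?_
        rw [mul_left_comm, key]
        ring
    _ = 0 := by simp only [hcoeff]; ring

end Relations

section Embedding

variable {p : ℕ}

lemma grad_add (F G : MvPolynomial (Fin 2) (ZMod p)) (x : Fin 2 → ZMod p) :
    grad (F + G) x = grad F x + grad G x := by
  ext i; simp [grad]

lemma grad_const_smul (c : ZMod p) (F : MvPolynomial (Fin 2) (ZMod p)) (x : Fin 2 → ZMod p) :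
    grad (c • F) x = c • grad F x := by
  ext i; simp [grad, Derivation.map_smul]

variable [hp : Fact p.Prime]

/-- The map `G ↦ ∑ v, v ^ N * ⟨∇G (rot v), (X, Y)⟩`. -/
noncomputable def embed (N : ℕ) :
    MvPolynomial (Fin 2) (ZMod p) →ₗ[ZMod p] MvPolynomial (Fin 2) (ZMod p) where
  toFun G := ∑ v, gen N v (grad G (rot v))
  map_add' F G := by simp only [grad_add, gen_add_right, sum_add_distrib]
  map_smul' c F := by simp only [grad_const_smul, gen_smul_right, smul_sum, RingHom.id_apply]

lemma embed_apply (N : ℕ) (G : MvPolynomial (Fin 2) (ZMod p)) :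
    embed N G = ∑ v, gen N v (grad G (rot v)) := rfl

lemma embed_matAct {m s N : ℕ} {G : MvPolynomial (Fin 2) (ZMod p)} (hG : G.IsHomogeneous m)
    (hd : s + (m - 1) = p - 1) (hs : s ≠ 0) (hN : N ≠ 0) (hNs : N ≡ s [MOD p - 1])
    (g : Matrix (Fin 2) (Fin 2) (ZMod p)) :
    embed N (g.det ^ s • matAct p g G) = matAct p g (embed N G) := by
  rw [map_smul, embed_apply, embed_apply, map_sum]
  simp only [matAct_gen]
  by_cases hg : g.det = 0
  · rw [hg, zero_pow hs, zero_smul]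
    obtain ⟨l, k, rfl⟩ := exists_vecMulVec_of_det_eq_zero hg
    have : ∀ v, vecMulVec l k *ᵥ v = (k ⬝ᵥ v) • l := fun v => by
      ext i
      simp only [mulVec, vecMulVec_apply, dotProduct, Fin.sum_univ_two, Pi.smul_apply, smul_eq_mul]
      ring
    simp only [this, gen_smul_left, gen_smul_right, smul_smul]
    simp only [← sum_smul, mul_comm (k ⬝ᵥ grad G _)]
    rw [sum_dotProduct_pow_mul_grad_rot hG (by omega) hs hN hNs, zero_smul]
  · have hinj : Function.Bijective fun v : Fin 2 → ZMod p => g *ᵥ v :=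
      Finite.injective_iff_bijective.mp
        (mulVec_injective_of_isUnit ((isUnit_iff_isUnit_det g).mpr (Ne.isUnit hg)))
    rw [← hinj.sum_comp, smul_sum]
    refine sum_congr rfl fun v _ => ?_
    rw [grad_matAct, rot_mulVec_vecMul, grad_smul hG, mulVec_smul, gen_smul_right, smul_smul,
      ← pow_add, hd, ZMod.pow_card_sub_one_eq_one hg, one_smul]

lemma sum_pow_mul_pow (i j : ℕ) : ∑ v : Fin 2 → ZMod p, v 0 ^ i * v 1 ^ j =
    (∑ x : ZMod p, x ^ i) * ∑ y : ZMod p, y ^ j := by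
  rw [sum_mul_sum, ← (finTwoArrowEquiv (ZMod p)).symm.sum_comp, Fintype.sum_prod_type]
  rfl

lemma eval_rot_eq_sum {m : ℕ} {G : MvPolynomial (Fin 2) (ZMod p)} (hG : G.IsHomogeneous m)
    (v : Fin 2 → ZMod p) : eval (rot v) G =
      ∑ k ∈ range (m + 1), coeff (mon (m - k) k) G * (-1) ^ (m - k) *
        (v 0 ^ k * v 1 ^ (m - k)) := by
  conv_lhs => rw [eq_sum_monomial_mon hG]
  rw [map_sum]
  refine sum_congr rfl fun k _ => ?_
  rw [monomial_mon]
  simp [rot, neg_pow (v 1)]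
  ring

/-- A moment of `G` that isolates one coefficient. -/
lemma sum_eval_rot_mul {m k i j : ℕ} {G : MvPolynomial (Fin 2) (ZMod p)} (hG : G.IsHomogeneous m)
    (hk : k < m) (hm : m ≤ p - 1) (hi : i + (m - k) = p - 1) (hj0 : j + k ≠ 0)
    (hj : p - 1 ∣ j + k) :
    ∑ v, eval (rot v) G * (v 0 ^ j * v 1 ^ i) = coeff (mon (m - k) k) G * (-1) ^ (m - k) := by
  have hp2 := hp.out.two_le
  calc _ = ∑ l ∈ range (m + 1), coeff (mon (m - l) l) G * (-1) ^ (m - l) *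
        ((∑ x : ZMod p, x ^ (j + l)) * ∑ y : ZMod p, y ^ (i + (m - l))) := by
        simp only [← sum_pow_mul_pow]
        simp only [mul_sum, eval_rot_eq_sum hG, sum_mul]
        rw [sum_comm]
        refine sum_congr rfl fun l _ => sum_congr rfl fun v _ => ?_
        ring
    _ = _ := by
        rw [sum_eq_single k]
        · rw [sum_pow_eq_neg_one hj0 hj, hi, sum_pow_eq_neg_one (by omega) dvd_rfl]
          ring
        · intro l hl hlk
          have hl := mem_range.mp hl
          rw [sum_pow_eq_zero (i := i + (m - l)), mul_zero, mul_zero]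
          rcases lt_or_gt_of_ne hlk with h | h
          · rw [show i + (m - l) = (p - 1) + (k - l) by omega, Nat.dvd_add_right dvd_rfl]
            exact Or.inr (Nat.not_dvd_of_pos_of_lt (by omega) (by omega))
          · rcases Nat.eq_zero_or_pos (i + (m - l)) with h' | h'
            · exact Or.inl h'
            · exact Or.inr (Nat.not_dvd_of_pos_of_lt h' (by omega))
        · intro h
          exact absurd (mem_range.mpr (by omega)) h

lemma embed_C_mul_X_pow_eq_zero {q m : ℕ} (hq : 1 < q) (hm0 : (m : ZMod p) ≠ 0)
    (hm : p - 1 ∣ p * q - p + (m - 1)) {c : ZMod p}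
    (h : embed (p * q - 1) (C c * X 1 ^ m) = 0) : c = 0 := by
  have hp2 := hp.out.two_le
  have hr : 2 * p ≤ p * q := by nlinarith
  have h1 := congrArg (coeff (mon (p * q - p) p)) h
  rw [embed_apply, coeff_sum, coeff_zero] at h1
  have hc : ((p * q - 1).choose (p * q - p) : ZMod p) = 1 := by
    rw [← cast_choose_pred_self (p := p) (by omega : 0 < q)]
    congr 1
    exact Nat.choose_symm_of_eq_add (by omega)
  have h2 : ∀ v : Fin 2 → ZMod p,
      coeff (mon (p * q - p) p) (gen (p * q - 1) v (grad (C c * X 1 ^ m) (rot v))) =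
        c * m * (v 0 ^ (p * q - p + (m - 1)) * v 1 ^ (p - 1)) := fun v => by
    have := coeff_gen v (grad (C c * X 1 ^ m) (rot v)) (N := p * q - 1) (i := p * q - p - 1)
      (j := p - 1) (by omega)
    rw [show p * q - p - 1 + 1 = p * q - p by omega, Nat.sub_add_cancel (by omega)] at this
    rw [this, hc]
    simp [grad, rot, Derivation.leibniz_pow, pow_add]
    ring
  simp only [h2, ← mul_sum, sum_pow_mul_pow] at h1
  rw [sum_pow_eq_neg_one (by omega) hm, sum_pow_eq_neg_one (by omega) dvd_rfl] at h1
  simpa [hm0] using h1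

lemma eq_zero_of_embed_eq_zero {q a : ℕ} (hq : 1 < q) (ha : 2 ≤ a) (hap : a ≤ p - 1)
    (hmod : p - 1 ∣ p * q - a) {G : MvPolynomial (Fin 2) (ZMod p)}
    (hG : G.IsHomogeneous (p - a + 1)) (h : embed (p * q - 1) G = 0) : G = 0 := by
  have hp2 := hp.out.two_le
  have hr : 2 * p ≤ p * q := by nlinarith
  have hm0 : ((p - a + 1 : ℕ) : ZMod p) ≠ 0 := by
    rw [Ne, ZMod.natCast_eq_zero_iff]
    exact Nat.not_dvd_of_pos_of_lt (by omega) (by omega)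
  have hsum := sum_cross_lin_pow_eq_zero (r := p * q) (by simp) (by omega) (c := 1) (v := id)
    (w := fun v => grad G (rot v)) (by simpa [embed_apply] using h)
  have hcoeff : ∀ k < p - a + 1, coeff (mon (p - a + 1 - k) k) G = 0 := fun k hk => by
    have h1 := congrArg (coeff (mon (p * q - 2 - (k + a - 2)) (k + a - 2))) hsum
    rw [coeff_sum, coeff_zero] at h1
    have h2 : ∀ v : Fin 2 → ZMod p, coeff (mon (p * q - 2 - (k + a - 2)) (k + a - 2))
        (((1 : (Fin 2 → ZMod p) → ZMod p) v * cross (id v) (grad G (rot v))) •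
          lin (id v) ^ (p * q - 2)) =
        ((p - a + 1 : ℕ) * (p * q - 2).choose (k + a - 2)) * (eval (rot v) G *
          (v 0 ^ (p * q - 2 - (k + a - 2)) * v 1 ^ (k + a - 2))) := fun v => by
      rw [coeff_smul, coeff_lin_pow _ (by omega), id_eq, cross_grad_rot hG,
        Nat.choose_symm (by omega)]
      simp only [Pi.one_apply, smul_eq_mul]
      ring
    simp only [h2, ← mul_sum] at h1
    rw [sum_eval_rot_mul hG hk (by omega) (by omega) (by omega)
      (by rwa [show p * q - 2 - (k + a - 2) + k = p * q - a by omega])] at h1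
    simpa [hm0, cast_choose_sub_two_ne_zero (p := p) (by omega : 0 < q)
      (by omega : k + a - 2 ≤ p - 2), -Nat.cast_add] using h1
  have hG' : G = C (coeff (mon 0 (p - a + 1)) G) * X 1 ^ (p - a + 1) := by
    conv_lhs => rw [eq_sum_monomial_mon hG, sum_range_succ, sum_eq_zero fun k hk => by
      rw [hcoeff k (mem_range.mp hk), monomial_zero]]
    rw [zero_add, Nat.sub_self, monomial_mon, pow_zero, one_mul]
  rw [hG'] at h
  rw [hG', embed_C_mul_X_pow_eq_zero hq hm0
    (by rwa [show p * q - p + (p - a + 1 - 1) = p * q - a by omega]) h, map_zero, zero_mul]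

end Embedding

section Powers

variable {p : ℕ}

/-- `v ^ N` depends on the coefficients of `v` as a form of degree `s`. -/
def IsPowForm (p s N : ℕ) : Prop :=
  ∃ Φ : MvPolynomial (Fin 2) (MvPolynomial (Fin 2) (ZMod p)), Φ.IsHomogeneous s ∧
    ∀ v : Fin 2 → ZMod p, eval (fun i => C (v i)) Φ = lin v ^ N

lemma IsPowForm.add {s t M N : ℕ} (hM : IsPowForm p s M) (hN : IsPowForm p t N) :
    IsPowForm p (s + t) (M + N) := by
  obtain ⟨Φ, hΦ, h1⟩ := hM
  obtain ⟨Ψ, hΨ, h2⟩ := hN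
  exact ⟨Φ * Ψ, hΦ.mul hΨ, fun v => by rw [map_mul, h1, h2, pow_add]⟩

lemma isPowForm_zero : IsPowForm p 0 0 := ⟨1, isHomogeneous_one _ _, fun v => by simp⟩

lemma isPowForm_one : IsPowForm p 1 1 :=
  ⟨∑ i, C (X i) * X i, IsHomogeneous.sum _ _ _ fun i _ => isHomogeneous_C_mul_X _ i, fun v => by
    simp [lin, mul_comm]⟩

lemma isPowForm_self (N : ℕ) : IsPowForm p N N := by
  induction N with
  | zero => exact isPowForm_zero
  | succ N ih => exact ih.add isPowForm_one

variable [hp : Fact p.Prime]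

lemma IsPowForm.prime_mul {s N : ℕ} (hN : IsPowForm p s N) : IsPowForm p s (p * N) := by
  obtain ⟨Φ, hΦ, h⟩ := hN
  refine ⟨map (frobenius _ p) Φ, hΦ.map _, fun v => ?_⟩
  rw [mul_comm, pow_mul, ← h, ← frobenius_def p (eval _ Φ), eval_map, ← eval₂_id,
    eval₂_comp_left, RingHom.comp_id]
  congr 1
  ext1 i
  simp only [Function.comp_apply, frobenius_def]
  rw [← map_pow, ZMod.pow_card]

lemma IsPowForm.prime_pow_mul {s N : ℕ} (hN : IsPowForm p s N) (n : ℕ) :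
    IsPowForm p s (p ^ n * N) := by
  induction n with
  | zero => simpa using hN
  | succ n ih => rw [pow_succ', mul_assoc]; exact ih.prime_mul

lemma isPowForm_digits_sum (N : ℕ) : IsPowForm p (Nat.digits p N).sum N := by
  induction N using Nat.strong_induction_on with
  | _ N ih =>
    rcases Nat.eq_zero_or_pos N with rfl | hN
    · simpa using isPowForm_zero
    · rw [Nat.digits_def' hp.out.one_lt hN, List.sum_cons]
      have := (isPowForm_self (N % p)).add (ih _ (Nat.div_lt_self hN hp.out.one_lt)).prime_mul
      rwa [Nat.mod_add_div] at this

lemma IsPowForm.exists_sum {s N : ℕ} (hN : IsPowForm p s N) :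
    ∃ H : Fin (s + 1) → MvPolynomial (Fin 2) (ZMod p), ∀ v : Fin 2 → ZMod p,
      lin v ^ N ∈ Submodule.span (ZMod p) (Set.range H) := by
  obtain ⟨Φ, hΦ, h⟩ := hN
  refine ⟨fun k => coeff (mon (s - k) k) Φ, fun v => ?_⟩
  have hsum := congrArg (eval fun i => C (v i)) (eq_sum_monomial_mon hΦ)
  rw [← h, hsum, map_sum]
  refine Submodule.sum_mem _ fun k hk => ?_
  have : eval (fun i => C (v i)) (monomial (mon (s - k) k) (coeff (mon (s - k) k) Φ)) =
      (v 0 ^ (s - k) * v 1 ^ k) • coeff (mon (s - k) k) Φ := by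
    rw [monomial_mon, smul_eq_C_mul]
    simp only [map_mul, map_pow, eval_C, eval_X]
    ring
  rw [this]
  exact Submodule.smul_mem _ _ (Submodule.subset_span ⟨⟨k, mem_range.mp hk⟩, rfl⟩)

end Powers

section Generated

variable {p : ℕ}

lemma gen_mem_Xr1Sub (r : ℕ) (v w : Fin 2 → ZMod p) : gen (r - 1) v w ∈ Xr1Sub p r :=
  Submodule.subset_span ⟨(of ![v, w])ᵀ, matAct_generator _ _⟩

lemma Xr1Sub_le {r : ℕ} {S : Submodule (ZMod p) (MvPolynomial (Fin 2) (ZMod p))}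
    (h : ∀ v w, gen (r - 1) v w ∈ S) : Xr1Sub p r ≤ S :=
  Submodule.span_le.mpr <| by
    rintro _ ⟨g, rfl⟩
    dsimp only
    rw [matAct_generator]
    exact h _ _

lemma matAct_mem_Xr1Sub {r : ℕ} (g : Matrix (Fin 2) (Fin 2) (ZMod p))
    {F : MvPolynomial (Fin 2) (ZMod p)} (hF : F ∈ Xr1Sub p r) : matAct p g F ∈ Xr1Sub p r := by
  refine Xr1Sub_le (S := (Xr1Sub p r).comap (matAct p g).toLinearMap) (fun v w => ?_) hF
  simpa [matAct_gen] using gen_mem_Xr1Sub r _ _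

instance finite_Xr1Sub [Fact p.Prime] (r : ℕ) : Module.Finite (ZMod p) (Xr1Sub p r) :=
  FiniteDimensional.span_of_finite _ (Set.finite_range _)

lemma equivMap_of_gen {r m k : ℕ} (φ : Xr1Sub p r →ₗ[ZMod p] Vh p m)
    (h : ∀ (g : Matrix (Fin 2) (Fin 2) (ZMod p)) (v w : Fin 2 → ZMod p),
      (φ ⟨_, gen_mem_Xr1Sub r (g *ᵥ v) (g *ᵥ w)⟩ : MvPolynomial (Fin 2) (ZMod p)) =
        twAct p k g (φ ⟨_, gen_mem_Xr1Sub r v w⟩)) : EquivMap p 0 k φ := by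
  intro g x y hxy
  let L : Xr1Sub p r →ₗ[ZMod p] Xr1Sub p r :=
    (matAct p g).toLinearMap.restrict fun _ => matAct_mem_Xr1Sub g
  have hy : y = L x := Subtype.ext (by rw [hxy, twAct, pow_zero, one_smul]; rfl)
  let φ₁ := (Vh p m).subtype ∘ₗ φ ∘ₗ L
  let φ₂ := (g.det ^ k • (matAct p g).toLinearMap) ∘ₗ (Vh p m).subtype ∘ₗ φ
  suffices φ₁ = φ₂ by rw [hy]; exact LinearMap.congr_fun this x
  have hL : ∀ v w, L ⟨_, gen_mem_Xr1Sub r v w⟩ = ⟨_, gen_mem_Xr1Sub r (g *ᵥ v) (g *ᵥ w)⟩ :=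
    fun v w => Subtype.ext (matAct_gen g _ v w)
  have hle : Xr1Sub p r ≤ (LinearMap.eqLocus φ₁ φ₂).map (Xr1Sub p r).subtype :=
    Xr1Sub_le fun v w => ⟨⟨_, gen_mem_Xr1Sub r v w⟩,
      (congrArg (fun z => (φ z : MvPolynomial (Fin 2) (ZMod p))) (hL v w)).trans (h g v w), rfl⟩
  ext1 z
  obtain ⟨z', hz', hzz⟩ := hle z.2
  rwa [← Subtype.ext hzz]

variable [hp : Fact p.Prime]

lemma finrank_Xr1Sub_le {r a : ℕ} (hr : r ≠ 0) (h : IsPowForm p a r) :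
    Module.finrank (ZMod p) (Xr1Sub p r) ≤ a + p + 2 := by
  obtain ⟨H, hH⟩ := h.exists_sum
  let B : Fin (a + 1) ⊕ Option (ZMod p) → MvPolynomial (Fin 2) (ZMod p) :=
    Sum.elim H fun o => o.elim (gen (r - 1) ![0, 1] ![1, 0]) fun t => gen (r - 1) ![1, t] ![0, 1]
  have hgen : ∀ v : Fin 2 → ZMod p, gen (r - 1) v v ∈ Submodule.span (ZMod p) (Set.range B) :=
    fun v => by
      rw [gen, pow_sub_one_mul hr]
      refine Submodule.span_mono ?_ (hH v)
      rintro _ ⟨i, rfl⟩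
      exact ⟨Sum.inl i, rfl⟩
  have hB : ∀ o, B (Sum.inr o) ∈ Submodule.span (ZMod p) (Set.range B) := fun o =>
    Submodule.subset_span ⟨_, rfl⟩
  have hle : Xr1Sub p r ≤ Submodule.span (ZMod p) (Set.range B) := Xr1Sub_le fun v w => by
    rcases eq_or_ne (v 0) 0 with h0 | h0
    · have hv : v = v 1 • ![0, 1] := by
        ext i; fin_cases i <;> simp [h0]
      have hw : w = w 1 • ![0, 1] + w 0 • ![1, 0] := by
        ext i; fin_cases i <;> simp
      rw [hv, hw, gen_smul_left, gen_add_right, gen_smul_right, gen_smul_right]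
      exact Submodule.smul_mem _ _ (Submodule.add_mem _ (Submodule.smul_mem _ _ (hgen _))
        (Submodule.smul_mem _ _ (hB none)))
    · have hv : v = v 0 • ![1, v 1 / v 0] := by
        ext i; fin_cases i <;> simp [mul_div_cancel₀, h0]
      have hw : w = w 0 • ![1, v 1 / v 0] + (w 1 - w 0 * (v 1 / v 0)) • ![0, 1] := by
        ext i; fin_cases i <;> simp
      rw [hv, hw, gen_smul_left, gen_add_right, gen_smul_right, gen_smul_right]
      exact Submodule.smul_mem _ _ (Submodule.add_mem _ (Submodule.smul_mem _ _ (hgen _))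
        (Submodule.smul_mem _ _ (hB (some (v 1 / v 0)))))
  have := FiniteDimensional.span_of_finite (ZMod p) (Set.finite_range B)
  refine (Submodule.finrank_mono hle).trans ((finrank_range_le_card B).trans_eq ?_)
  simp
  ring

lemma exists_projection {q a : ℕ} (hq : 2 < q) (ha : 2 ≤ a) (hap : a ≤ p - 1)
    (hmod : p * q ≡ a [MOD p - 1]) (hq2 : a = 2 → (q : ZMod p) ≠ 2) :
    ∃ π : Xr1Sub p (p * q) →ₗ[ZMod p] Vh p (a - 2) × Vh p a, ∀ v w,
      ((π ⟨_, gen_mem_Xr1Sub _ v w⟩).1 : MvPolynomial (Fin 2) (ZMod p)) =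
        cross v w • lin v ^ (a - 2) ∧
      ((π ⟨_, gen_mem_Xr1Sub _ v w⟩).2 : MvPolynomial (Fin 2) (ZMod p)) = gen (a - 1) v w := by
  have hr : 2 * p < p * q := by have := hp.out.pos; nlinarith
  have key : ∀ j ≤ a, p * q - j ≡ a - j [MOD p - 1] := fun j hj =>
    Nat.ModEq.add_right_cancel' j (by rwa [Nat.sub_add_cancel hj, Nat.sub_add_cancel (by omega)])
  obtain ⟨π, hπ⟩ := exists_linearMap_span (K := ZMod p) (W := Vh p (a - 2) × Vh p a)
    (fun g : Matrix (Fin 2) (Fin 2) (ZMod p) => matAct p g (X 0 ^ (p * q - 1) * X 1))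
    (fun g => (⟨g.det • lin (gᵀ 0) ^ (a - 2), Submodule.smul_mem _ _
        (mem_Vh.mpr (isHomogeneous_lin_pow _ _))⟩,
      ⟨gen (a - 1) (gᵀ 0) (gᵀ 1), mem_Vh.mpr (by
        simpa [Nat.sub_add_cancel (by omega : 1 ≤ a)] using
          isHomogeneous_gen (a - 1) (gᵀ 0) (gᵀ 1))⟩))
    fun c hc => by
      simp only [matAct_generator] at hc
      refine Prod.ext (Subtype.ext ?_) (Subtype.ext ?_)
      · simp only [Prod.fst_sum, Prod.smul_fst, Submodule.coe_sum, Submodule.coe_smul,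
          Prod.fst_zero, Submodule.coe_zero, det_eq_cross, smul_smul]
        rcases ha.eq_or_lt with rfl | ha
        · simp only [Nat.sub_self, pow_zero, ← sum_smul]
          rw [sum_cross_eq_zero hq (hq2 rfl) hmod hc, zero_smul]
        · refine eq_zero_of_forall_eval (m := a - 2) ?_ (by omega) fun x => ?_
          · exact IsHomogeneous.sum _ _ _ fun g _ =>
              Submodule.smul_mem (Vh p (a - 2)) _ (mem_Vh.mpr (isHomogeneous_lin_pow _ _))
          · have := congrArg (eval x) (sum_cross_lin_pow_eq_zero (by simp) (by omega) hc)
            simpa only [map_sum, map_zero, smul_eval, map_pow,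
              pow_eq_pow_of_modEq (key 2 ha.le) (by omega) (by omega)] using this
      · simpa only [Prod.snd_sum, Prod.smul_snd, Submodule.coe_sum, Submodule.coe_smul,
          Prod.snd_zero, Submodule.coe_zero] using
          sum_gen_eq_zero (by omega) (by omega) (key 1 (by omega)) (by omega) hc
  refine ⟨π, fun v w => ?_⟩
  have hgen : matAct p (of ![v, w])ᵀ (X 0 ^ (p * q - 1) * X 1) = gen (p * q - 1) v w :=
    matAct_generator _ _
  have h := hπ (of ![v, w])ᵀ (Submodule.subset_span ⟨_, rfl⟩)
  simp only [hgen, det_eq_cross] at h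
  exact ⟨congrArg (fun z => (z.1 : MvPolynomial (Fin 2) (ZMod p))) h,
    congrArg (fun z => (z.2 : MvPolynomial (Fin 2) (ZMod p))) h⟩

end Generated

section Sequence

variable {p : ℕ} [hp : Fact p.Prime]

lemma exists_cross_eq_one {v : Fin 2 → ZMod p} (hv : v ≠ 0) : ∃ w, cross v w = 1 := by
  rcases eq_or_ne (v 0) 0 with h0 | h0
  · have h1 : v 1 ≠ 0 := fun h1 => hv (by ext i; fin_cases i <;> simp [h0, h1])
    exact ⟨![-(v 1)⁻¹, 0], by simp [cross, h1]⟩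
  · exact ⟨![0, (v 0)⁻¹], by simp [cross, h0]⟩

variable {r a : ℕ} {π : Xr1Sub p r →ₗ[ZMod p] Vh p (a - 2) × Vh p a}

lemma surjective_of_gen (ha : 2 ≤ a) (hap : a < p)
    (h1 : ∀ v w, ((π ⟨_, gen_mem_Xr1Sub r v w⟩).1 : MvPolynomial (Fin 2) (ZMod p)) =
      cross v w • lin v ^ (a - 2))
    (h2 : ∀ v w, ((π ⟨_, gen_mem_Xr1Sub r v w⟩).2 : MvPolynomial (Fin 2) (ZMod p)) =
      gen (a - 1) v w) : Function.Surjective π := by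
  have hsnd : ∀ G : Vh p a, (0, G) ∈ LinearMap.range π := fun G => by
    have : Vh p a ≤ ((LinearMap.range π).comap (LinearMap.inr _ _ _)).map (Vh p a).subtype := by
      refine (Vh_le_span_lin_pow hap).trans (Submodule.span_le.mpr ?_)
      rintro _ ⟨v, rfl⟩
      refine ⟨⟨lin v ^ a, mem_Vh.mpr (isHomogeneous_lin_pow v a)⟩,
        ⟨⟨_, gen_mem_Xr1Sub r v v⟩, Prod.ext (Subtype.ext ?_) (Subtype.ext ?_)⟩, rfl⟩
      · simp [h1, cross]
      · exact (h2 v v).trans (pow_sub_one_mul (by omega) _)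
    obtain ⟨G', hG', hGG⟩ := this G.2
    rwa [← Subtype.ext hGG]
  have hfst : ∀ F : Vh p (a - 2), (F, 0) ∈ LinearMap.range π := fun F => by
    have hv : ∀ v : Fin 2 → ZMod p, v ≠ 0 → lin v ^ (a - 2) ∈
        ((LinearMap.range π).comap (LinearMap.inl _ _ _)).map (Vh p (a - 2)).subtype := by
      intro v hv
      obtain ⟨w, hw⟩ := exists_cross_eq_one hv
      refine ⟨⟨lin v ^ (a - 2), mem_Vh.mpr (isHomogeneous_lin_pow v _)⟩, ?_, rfl⟩
      have hsub := Submodule.sub_mem _ (LinearMap.mem_range_self π ⟨_, gen_mem_Xr1Sub r v w⟩)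
        (hsnd (π ⟨_, gen_mem_Xr1Sub r v w⟩).2)
      refine (congrArg (· ∈ LinearMap.range π) (Prod.ext (Subtype.ext ?_) ?_)).mp hsub
      · simp [h1, hw]
      · simp
    have : Vh p (a - 2) ≤
        ((LinearMap.range π).comap (LinearMap.inl _ _ _)).map (Vh p (a - 2)).subtype := by
      refine (Vh_le_span_lin_pow (by omega)).trans (Submodule.span_le.mpr ?_)
      rintro _ ⟨v, rfl⟩
      rcases eq_or_ne v 0 with rfl | h0
      · rcases ha.eq_or_lt with rfl | ha
        · simpa using hv ![1, 0] fun h => one_ne_zero (congrFun h 0)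
        · have h0 : lin (0 : Fin 2 → ZMod p) ^ (a - 2) = 0 := by
            rw [show lin (0 : Fin 2 → ZMod p) = 0 by simp [lin], zero_pow (by omega)]
          dsimp only
          rw [h0]
          exact zero_mem _
      · exact hv v h0
    obtain ⟨F', hF', hFF⟩ := this F.2
    rwa [← Subtype.ext hFF]
  rintro ⟨F, G⟩
  rw [← LinearMap.mem_range]
  simpa using Submodule.add_mem _ (hfst F) (hsnd G)

lemma embed_mem_Xr1Sub (G : MvPolynomial (Fin 2) (ZMod p)) : embed (r - 1) G ∈ Xr1Sub p r :=
  Submodule.sum_mem _ fun _ _ => gen_mem_Xr1Sub _ _ _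

lemma projection_embed (ha : 2 ≤ a) (hap : a ≤ p - 1)
    (h1 : ∀ v w, ((π ⟨_, gen_mem_Xr1Sub r v w⟩).1 : MvPolynomial (Fin 2) (ZMod p)) =
      cross v w • lin v ^ (a - 2))
    (h2 : ∀ v w, ((π ⟨_, gen_mem_Xr1Sub r v w⟩).2 : MvPolynomial (Fin 2) (ZMod p)) =
      gen (a - 1) v w) {G : MvPolynomial (Fin 2) (ZMod p)} (hG : G.IsHomogeneous (p - a + 1)) :
    π ⟨_, embed_mem_Xr1Sub G⟩ = 0 := by
  have hsum : (⟨_, embed_mem_Xr1Sub G⟩ : Xr1Sub p r) =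
      ∑ v, ⟨_, gen_mem_Xr1Sub r v (grad G (rot v))⟩ :=
    Subtype.ext (by simp [embed_apply])
  rw [hsum, map_sum]
  refine Prod.ext (Subtype.ext ?_) (Subtype.ext ?_)
  · simp only [Prod.fst_sum, Submodule.coe_sum, h1, Prod.fst_zero, Submodule.coe_zero,
      cross_grad_rot hG]
    refine eq_zero_of_forall_eval (m := a - 2) ?_ (by omega) fun x => ?_
    · exact IsHomogeneous.sum _ _ _ fun v _ =>
        Submodule.smul_mem (Vh p (a - 2)) _ (mem_Vh.mpr (isHomogeneous_lin_pow _ _))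
    · have := sum_dotProduct_pow_mul_eval_rot hG (s := a - 2) (by omega) x
      simp only [map_sum, smul_eval, map_pow, eval_lin, mul_assoc, ← mul_sum]
      simp only [mul_comm (eval _ G), this, mul_zero]
  · simp only [Prod.snd_sum, Submodule.coe_sum, h2, Prod.snd_zero, Submodule.coe_zero]
    refine eq_zero_of_forall_eval (m := a - 1 + 1) ?_ (by omega) fun x => ?_
    · exact IsHomogeneous.sum _ _ _ fun v _ => isHomogeneous_gen _ _ _
    · simp only [map_sum, eval_gen]
      exact sum_dotProduct_pow_mul_grad_rot hG (by omega) (by omega) (by omega) rfl x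

lemma equivMap_fst (h1 : ∀ v w,
    ((π ⟨_, gen_mem_Xr1Sub r v w⟩).1 : MvPolynomial (Fin 2) (ZMod p)) =
      cross v w • lin v ^ (a - 2)) :
    EquivMap p 0 1 ((LinearMap.fst (ZMod p) (Vh p (a - 2)) (Vh p a)).comp π) :=
  equivMap_of_gen _ fun g v w => by
    simp only [LinearMap.comp_apply, LinearMap.fst_apply, h1, twAct, cross_mulVec, map_smul,
      map_pow, matAct_lin, smul_smul, pow_one]

lemma equivMap_snd (h2 : ∀ v w,
    ((π ⟨_, gen_mem_Xr1Sub r v w⟩).2 : MvPolynomial (Fin 2) (ZMod p)) = gen (a - 1) v w) :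
    EquivMap p 0 0 ((LinearMap.snd (ZMod p) (Vh p (a - 2)) (Vh p a)).comp π) :=
  equivMap_of_gen _ fun g v w => by
    simp [h2, twAct, matAct_gen]

theorem exists_exact_sequence {q : ℕ} (hq : 2 < q) (ha : 2 ≤ a) (hap : a ≤ p - 1)
    (hmod : p * q ≡ a [MOD p - 1]) (hq2 : a = 2 → (q : ZMod p) ≠ 2)
    (hform : IsPowForm p a (p * q)) :
    Module.finrank (ZMod p) (Xr1Sub p (p * q)) = a + p + 2 ∧
    ∃ (ι : Vh p (p - a + 1) →ₗ[ZMod p] Xr1Sub p (p * q))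
      (π : Xr1Sub p (p * q) →ₗ[ZMod p] Vh p (a - 2) × Vh p a),
      Function.Injective ι ∧ Function.Surjective π ∧
      LinearMap.ker π = LinearMap.range ι ∧
      EquivMap p (a - 1) 0 ι ∧
      EquivMap p 0 1 ((LinearMap.fst (ZMod p) (Vh p (a - 2)) (Vh p a)).comp π) ∧
      EquivMap p 0 0 ((LinearMap.snd (ZMod p) (Vh p (a - 2)) (Vh p a)).comp π) := by
  have hr : 2 * p < p * q := by have := hp.out.pos; nlinarith
  obtain ⟨π, hπ⟩ := exists_projection hq ha hap hmod hq2
  have h1 := fun v w => (hπ v w).1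
  have h2 := fun v w => (hπ v w).2
  let ι : Vh p (p - a + 1) →ₗ[ZMod p] Xr1Sub p (p * q) :=
    (embed (p * q - 1)).restrict fun G _ => embed_mem_Xr1Sub G
  have hι : Function.Injective ι := (injective_iff_map_eq_zero ι).mpr fun G hG =>
    Subtype.ext (eq_zero_of_embed_eq_zero (by omega) ha hap
      ((Nat.modEq_iff_dvd' (by omega)).mp hmod.symm) G.2 (congrArg Subtype.val hG))
  have hsurj : Function.Surjective π := surjective_of_gen ha (by omega) h1 h2
  have hle : LinearMap.range ι ≤ LinearMap.ker π := by
    rintro _ ⟨G, rfl⟩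
    exact projection_embed ha hap h1 h2 G.2
  have hrank := LinearMap.finrank_range_add_finrank_ker π
  rw [LinearMap.range_eq_top.mpr hsurj, finrank_top, Module.finrank_prod, finrank_Vh,
    finrank_Vh] at hrank
  have hrange : Module.finrank (ZMod p) (LinearMap.range ι) = p - a + 1 + 1 := by
    rw [LinearMap.finrank_range_of_inj hι, finrank_Vh]
  have hmono := Submodule.finrank_mono hle
  have hupper := finrank_Xr1Sub_le (by omega) hform
  refine ⟨by omega, ι, π, hι, hsurj,
    (Submodule.eq_of_le_of_finrank_eq hle (by omega)).symm, fun g x y hxy => ?_,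
    equivMap_fst h1, equivMap_snd h2⟩
  have hmod1 : p * q - 1 ≡ a - 1 [MOD p - 1] := Nat.ModEq.add_right_cancel' 1
    (by rwa [Nat.sub_add_cancel (by omega), Nat.sub_add_cancel (by omega)])
  rw [twAct, pow_zero, one_smul]
  change embed (p * q - 1) y.1 = matAct p g (embed (p * q - 1) x.1)
  rw [hxy]
  exact embed_matAct x.2 (by omega) (by omega) (by omega) hmod1 g

/-- If the digit sum of `u - 1` is `1` and `2 < p ^ n * u`, then `p ^ n * u ≢ 2` mod `p`. -/
lemma cast_pow_mul_ne_two (hp3 : 3 ≤ p) {n u : ℕ} (hq : 2 < p ^ n * u)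
    (hsig : (Nat.digits p (u - 1)).sum = 1) : ((p ^ n * u : ℕ) : ZMod p) ≠ 2 := by
  intro h
  have hmod : p ^ n * u ≡ 2 [MOD p] := (ZMod.natCast_eq_natCast_iff _ _ _).mp (by simpa using h)
  have h2 : 2 % p = 2 := Nat.mod_eq_of_lt (by omega)
  have hmod' : p ^ n * u % p = 2 := Eq.trans hmod h2
  rcases n with _ | n
  · rw [pow_zero, one_mul] at hmod' hq
    have hdiv := Nat.mod_add_div u p
    rw [hmod'] at hdiv
    have hpos : 0 < u / p := Nat.pos_of_ne_zero fun h0 => by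
      rw [h0, mul_zero] at hdiv; omega
    have hu1 : u - 1 = 1 + p * (u / p) := by omega
    rw [hu1, Nat.digits_add p (by omega) 1 _ (by omega) (Or.inl one_ne_zero),
      List.sum_cons] at hsig
    have h0 : (Nat.digits p (u / p)).sum = 0 := by omega
    exact Nat.getLast_digit_ne_zero p hpos.ne' (List.sum_eq_zero_iff.mp h0 _ (List.getLast_mem _))
  · rw [pow_succ', mul_assoc, Nat.mul_mod_right] at hmod'
    omega

end Sequence

end Xr1

/-- For a prime `p ≥ 3`, `r = p^n u > 2p` with `p ∤ u`, `n > 0`,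
`r ≡ a mod (p−1)` with `2 ≤ a ≤ p−1`, and `Σ_p(u−1) = a − 1`, one has
`dim X_{r−1} = a + p + 2` and a short exact sequence of `M`-equivariant maps
`0 → V_{p−a+1} ⊗ D^{a−1} → X_{r−1} → (V_{a−2} ⊗ D) ⊕ V_a → 0`. -/
theorem Xr1_ses_mid (p r a n u : ℕ) (hp : p.Prime) (hp3 : 3 ≤ p) (hr : 2 * p < r)
    (ha : 2 ≤ a) (ha2 : a ≤ p - 1) (hmod : r ≡ a [MOD p - 1])
    (hru : r = p ^ n * u) (hu : ¬ p ∣ u) (hn : 0 < n)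
    (hsig : (Nat.digits p (u - 1)).sum = a - 1) :
    Module.finrank (ZMod p) ↥(Xr1Sub p r) = a + p + 2 ∧
    ∃ (ι : ↥(Vh p (p - a + 1)) →ₗ[ZMod p] ↥(Xr1Sub p r))
      (π : ↥(Xr1Sub p r) →ₗ[ZMod p] (↥(Vh p (a - 2)) × ↥(Vh p a))),
      Function.Injective ι ∧ Function.Surjective π ∧
      LinearMap.ker π = LinearMap.range ι ∧
      EquivMap p (a - 1) 0 ι ∧
      EquivMap p 0 1 ((LinearMap.fst (ZMod p) ↥(Vh p (a - 2)) ↥(Vh p a)).comp π) ∧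
      EquivMap p 0 0 ((LinearMap.snd (ZMod p) ↥(Vh p (a - 2)) ↥(Vh p a)).comp π) := by
  have := Fact.mk hp
  obtain ⟨n, rfl⟩ := Nat.exists_eq_add_of_le' hn
  have hrq : r = p * (p ^ n * u) := by rw [hru, pow_succ', mul_assoc]
  have hq : 2 < p ^ n * u := by
    rw [hrq, mul_comm] at hr
    exact Nat.lt_of_mul_lt_mul_left hr
  have hu1 : u - 1 + 1 = u := Nat.sub_add_cancel (Nat.pos_of_ne_zero fun h => hu (h ▸ dvd_zero p))
  have hform : Xr1.IsPowForm p a r := by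
    have := ((Xr1.isPowForm_digits_sum (p := p) (u - 1)).add Xr1.isPowForm_one).prime_pow_mul
      (n + 1)
    rwa [hu1, hsig, Nat.sub_add_cancel (by omega), ← hru] at this
  subst hrq
  refine Xr1.exists_exact_sequence hq ha ha2 hmod (fun h2 => ?_) hform
  subst h2
  exact Xr1.cast_pow_mul_ne_two hp3 hq hsig
end

section
/- Let p ≥ 3 be a prime, r > 2p an integer with r ≡ a mod (p−1) where 2 ≤ a ≤ p−1. Write r = p^n·u with p ∤ u and suppose Σ_p(u−1) > a−1 (equivalently Σ_p(u−1) ≥ p+a−2). Then dim_{F_p} X_{r−1} = 2p + 2, and there is a short exact sequence of M-equivariant F_p-linear maps 0 → (V_{p−a−1} ⊗ D^a) ⊕ (V_{p−a+1} ⊗ D^{a−1}) → X_{r−1} → (V_{a−2} ⊗ D) ⊕ V_a → 0. -/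
open MvPolynomial

/-- The sum of the base-`p` digits splits off the lowest digit. -/
theorem digits_sum_eq {p : ℕ} (hp : 1 < p) (N : ℕ) :
    (p.digits N).sum = N % p + (p.digits (N / p)).sum := by
  rcases Nat.eq_zero_or_pos N with rfl | hN
  · simp
  · rw [Nat.digits_def' hp hN, List.sum_cons]

/-- Every value up to the digit sum of `N` is the digit sum of some `j` such that
`N.choose j` is prime to `p`. -/
theorem exists_digits_sum_eq_not_dvd_choose {p : ℕ} (hp : p.Prime) (N s : ℕ)
    (hs : s ≤ (p.digits N).sum) : ∃ j, (p.digits j).sum = s ∧ ¬ p ∣ N.choose j := by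
  have := Fact.mk hp
  induction N using Nat.strong_induction_on generalizing s with
  | _ N ih =>
    rcases Nat.eq_zero_or_pos N with rfl | hN
    · exact ⟨0, by simp_all, by simpa using hp.one_lt.ne'⟩
    · rw [digits_sum_eq hp.one_lt] at hs
      obtain ⟨j, hj, hd⟩ := ih (N / p) (Nat.div_lt_self hN hp.one_lt) (s - min (N % p) s)
        (by omega)
      have hlt : min (N % p) s < p := (min_le_left _ _).trans_lt (Nat.mod_lt _ hp.pos)
      have hmod : (p * j + min (N % p) s) % p = min (N % p) s := by
        rw [Nat.mul_add_mod, Nat.mod_eq_of_lt hlt]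
      have hdiv : (p * j + min (N % p) s) / p = j := by
        rw [Nat.mul_add_div hp.pos, Nat.div_eq_of_lt hlt, add_zero]
      refine ⟨p * j + min (N % p) s, ?_, ?_⟩
      · rw [digits_sum_eq hp.one_lt, hmod, hdiv, hj]
        omega
      · rw [(Choose.choose_modEq_choose_mod_mul_choose_div_nat (p := p)).dvd_iff dvd_rfl, hmod,
          hdiv, hp.dvd_mul, not_or]
        refine ⟨fun h => ?_, hd⟩
        have hle : min (N % p) s ≤ N % p := min_le_left _ _
        have h1 := (Nat.Prime.dvd_factorial hp).1
          (h.trans ⟨_, ((mul_assoc _ _ _).symm.trans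
            (Nat.choose_mul_factorial_mul_factorial hle)).symm⟩)
        exact absurd (Nat.mod_lt N hp.pos) (by omega)

/-- If the digit sum of `N` is at least `p - 1`, some positive multiple `j` of `p - 1` has
`N.choose j` prime to `p`. -/
theorem exists_dvd_not_dvd_choose {p : ℕ} (hp : p.Prime) (hp3 : 3 ≤ p) {N : ℕ}
    (hN : p - 1 ≤ (p.digits N).sum) :
    ∃ j, 0 < j ∧ p - 1 ∣ j ∧ (p.digits j).sum = p - 1 ∧ ¬ p ∣ N.choose j := by
  obtain ⟨j, hj, hd⟩ := exists_digits_sum_eq_not_dvd_choose hp N _ hN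
  refine ⟨j, ?_, ?_, hj, hd⟩
  · rcases Nat.eq_zero_or_pos j with rfl | h
    · simp at hj; omega
    · exact h
  · have h := Nat.modEq_digits_sum (p - 1) p
      (Nat.mod_eq_of_modEq (by simpa using (Nat.modEq_sub (show 1 ≤ p by omega))) (by omega)) j
    rw [hj] at h
    exact (h.dvd_iff dvd_rfl).2 dvd_rfl

/-- The numerical input: a digit condition on `r` yields two binomial coefficients prime
to `p`. -/
theorem exists_choose_of_digits_sum {p r a n u : ℕ} (hp : p.Prime) (hp3 : 3 ≤ p)
    (ha : 2 ≤ a) (hmod : r ≡ a [MOD p - 1]) (hru : r = p ^ n * u) (hu : ¬ p ∣ u)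
    (hsig : a - 1 < (p.digits (u - 1)).sum) :
    (∃ j, 0 < j ∧ p - 1 ∣ j ∧ ¬ p ∣ (r - 1).choose j) ∧
      ∃ j, 0 < j ∧ j ≠ r ∧ p - 1 ∣ j ∧ ¬ p ∣ r.choose j := by
  have hp1 : p % (p - 1) = 1 :=
    Nat.mod_eq_of_modEq (by simpa using (Nat.modEq_sub (show 1 ≤ p by omega))) (by omega)
  have hu0 : 0 < u := Nat.pos_of_ne_zero fun h => hu (h ▸ dvd_zero p)
  have hua : u ≡ a [MOD p - 1] := by
    have h1 : p ^ n * u ≡ 1 ^ n * u [MOD p - 1] := by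
      refine Nat.ModEq.mul_right _ (Nat.ModEq.pow _ ?_)
      rw [Nat.ModEq, hp1, Nat.mod_eq_of_lt (by omega)]
    rw [one_pow, one_mul, ← hru] at h1
    exact h1.symm.trans hmod
  have hsum : a - 1 ≡ (p.digits (u - 1)).sum [MOD p - 1] := by
    refine Nat.ModEq.trans (Nat.ModEq.add_right_cancel' 1 ?_) (Nat.modEq_digits_sum _ _ hp1 _)
    rw [Nat.sub_add_cancel hu0, Nat.sub_add_cancel (by omega)]
    exact hua.symm
  have hge : p - 1 < (p.digits (u - 1)).sum := by
    have h := (Nat.modEq_iff_dvd' hsig.le).1 hsum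
    have := Nat.le_of_dvd (by omega) h
    omega
  have hmu : 0 < u % p := Nat.pos_of_ne_zero fun h => hu (Nat.dvd_of_mod_eq_zero h)
  have hsu : (p.digits r).sum = (p.digits (u - 1)).sum + 1 := by
    rw [hru, Nat.digits_base_pow_mul hp.one_lt hu0, List.sum_append, List.sum_replicate,
      smul_zero, zero_add, digits_sum_eq hp.one_lt u, digits_sum_eq hp.one_lt (u - 1)]
    have h0 := Nat.mod_lt u hp.pos
    have h1 : u - 1 = p * (u / p) + (u % p - 1) := by
      have := Nat.div_add_mod u p; omega
    have h2 : (u - 1) % p = u % p - 1 := by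
      rw [h1, Nat.mul_add_mod, Nat.mod_eq_of_lt (by omega)]
    have h3 : (u - 1) / p = u / p := by
      conv_lhs => rw [h1]
      rw [Nat.mul_add_div hp.pos, Nat.div_eq_of_lt (show u % p - 1 < p by omega), add_zero]
    rw [h2, h3]; omega
  constructor
  · have hr1 : p - 1 ≤ (p.digits (r - 1)).sum := by
      rcases Nat.eq_zero_or_pos n with rfl | hn
      · rw [hru, pow_zero, one_mul]; exact hge.le
      · have hd : p ∣ r := hru ▸ (dvd_pow_self p hn.ne').mul_right u
        obtain ⟨k, rfl⟩ := hd
        rw [digits_sum_eq hp.one_lt]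
        have hk : k ≠ 0 := by
          rintro rfl
          simp at hsu
        have h1 : p * k - 1 = p * (k - 1) + (p - 1) := by
          obtain ⟨k, rfl⟩ := Nat.exists_eq_succ_of_ne_zero hk
          rw [Nat.succ_eq_add_one, mul_add, Nat.add_sub_cancel]; omega
        rw [h1, Nat.mul_add_mod, Nat.mod_eq_of_lt (by omega)]
        exact Nat.le_add_right _ _
    obtain ⟨j, h1, h2, -, h3⟩ := exists_dvd_not_dvd_choose hp hp3 hr1
    exact ⟨j, h1, h2, h3⟩
  · obtain ⟨j, h1, h2, h4, h3⟩ := exists_dvd_not_dvd_choose hp hp3 (N := r) (by omega)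
    refine ⟨j, h1, ?_, h2, h3⟩
    rintro rfl
    omega

/-- Power sums over `F_p`. -/
theorem sum_zmod_pow {p : ℕ} [Fact p.Prime] {i : ℕ} (hi : 0 < i) :
    ∑ t : ZMod p, t ^ i = if p - 1 ∣ i then -1 else 0 := by
  classical
  have h := FiniteField.sum_pow_units (ZMod p) i
  rw [ZMod.card] at h
  rw [← h, ← Finset.sum_erase (Finset.univ : Finset (ZMod p)) (f := fun t => t ^ i) (a := 0)
    (zero_pow hi.ne')]
  symm
  refine Finset.sum_bij (fun x _ => (x : ZMod p)) (by simp) (fun _ _ _ _ h => Units.ext h) ?_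
    (fun _ _ => by simp)
  intro b hb
  exact ⟨Units.mk0 b (by simpa using hb), by simp, rfl⟩

/-- Positive exponents that agree modulo `p - 1` give the same power map on `F_p`. -/
theorem zmod_pow_eq_of_modEq {p : ℕ} [hp : Fact p.Prime] {k l : ℕ} (hk : 0 < k) (hl : 0 < l)
    (h : k ≡ l [MOD p - 1]) (c : ZMod p) : c ^ k = c ^ l := by
  rcases eq_or_ne c 0 with rfl | hc
  · rw [zero_pow hk.ne', zero_pow hl.ne']
  · exact pow_eq_pow_of_modEq h (ZMod.pow_card_sub_one_eq_one hc)

/-- The linear form `v₀ X + v₁ Y`. -/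
noncomputable def linForm (p : ℕ) : (Fin 2 → ZMod p) →ₗ[ZMod p] MvPolynomial (Fin 2) (ZMod p) where
  toFun v := C (v 0) * X 0 + C (v 1) * X 1
  map_add' v w := by simp only [Pi.add_apply, map_add]; ring
  map_smul' c v := by
    simp only [Pi.smul_apply, smul_eq_mul, map_mul, RingHom.id_apply, smul_eq_C_mul]; ring

theorem linForm_apply (p : ℕ) (v : Fin 2 → ZMod p) :
    linForm p v = C (v 0) * X 0 + C (v 1) * X 1 := rfl

theorem isHomogeneous_linForm (p : ℕ) (v : Fin 2 → ZMod p) : (linForm p v).IsHomogeneous 1 :=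
  (isHomogeneous_C_mul_X _ _).add (isHomogeneous_C_mul_X _ _)

theorem matAct_X (p : ℕ) (g : Matrix (Fin 2) (Fin 2) (ZMod p)) (i : Fin 2) :
    matAct p g (X i) = linForm p (g.col i) := by
  simp [matAct, linForm_apply, Fin.sum_univ_two]

theorem matAct_linForm (p : ℕ) (g : Matrix (Fin 2) (Fin 2) (ZMod p)) (v : Fin 2 → ZMod p) :
    matAct p g (linForm p v) = linForm p (g.mulVec v) := by
  simp only [linForm_apply, map_add, map_mul, matAct_X, algHom_C, algebraMap_eq, Matrix.mulVec,
    dotProduct, Fin.sum_univ_two, Matrix.col_apply]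
  ring

theorem linForm_smul_pow (p k : ℕ) (c : ZMod p) (v : Fin 2 → ZMod p) :
    linForm p (c • v) ^ k = c ^ k • linForm p v ^ k := by
  rw [map_smul, smul_pow]

/-- `X_{r-1}` is spanned by the products `l ^ (r - 1) * m` of linear forms. -/
theorem Xr1Sub_eq_span (p r : ℕ) : Xr1Sub p r = Submodule.span (ZMod p)
    (Set.range fun q : (Fin 2 → ZMod p) × (Fin 2 → ZMod p) =>
      linForm p q.1 ^ (r - 1) * linForm p q.2) := by
  unfold Xr1Sub
  congr 1
  ext F
  constructor
  · rintro ⟨g, rfl⟩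
    exact ⟨(g.col 0, g.col 1), by simp only [map_mul, map_pow, matAct_X]⟩
  · rintro ⟨⟨v, m⟩, rfl⟩
    refine ⟨Matrix.of fun i j => if j = 0 then v i else m i, ?_⟩
    simp only [map_mul, map_pow, matAct_X]
    congr 2

theorem linForm_pow_mul_mem (p r : ℕ) (v m : Fin 2 → ZMod p) :
    linForm p v ^ (r - 1) * linForm p m ∈ Xr1Sub p r :=
  Xr1Sub_eq_span p r ▸ Submodule.subset_span ⟨(v, m), rfl⟩

/-- Representatives of the lines in `F_p²`. -/
def lineRep (p : ℕ) : Option (ZMod p) → Fin 2 → ZMod p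
  | none => ![1, 0]
  | some t => ![t, 1]

theorem exists_eq_smul_lineRep {p : ℕ} [Fact p.Prime] (v : Fin 2 → ZMod p) :
    ∃ (c : ZMod p) (o : Option (ZMod p)), v = c • lineRep p o := by
  by_cases h : v 1 = 0
  · exact ⟨v 0, none, by ext i; fin_cases i <;> simp [lineRep, h]⟩
  · exact ⟨v 1, some (v 0 / v 1), by ext i; fin_cases i <;> simp [lineRep]; field_simp⟩

/-- The linear map sending a family `w` of linear forms indexed by the lines `l` to
`∑ l ^ k * w_l`. -/
noncomputable def lineSum (p k : ℕ) [NeZero p] :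
    (Option (ZMod p) → Fin 2 → ZMod p) →ₗ[ZMod p] MvPolynomial (Fin 2) (ZMod p) :=
  ∑ o, (LinearMap.mulLeft (ZMod p) (linForm p (lineRep p o) ^ k)).comp
    ((linForm p).comp (LinearMap.proj o))

theorem lineSum_apply (p k : ℕ) [NeZero p] (w : Option (ZMod p) → Fin 2 → ZMod p) :
    lineSum p k w = ∑ o, linForm p (lineRep p o) ^ k * linForm p (w o) := by
  simp [lineSum]

/-- The determinant of the matrix with columns `v` and `m`, as a linear form in `m`. -/
def crossForm (p : ℕ) (v : Fin 2 → ZMod p) : (Fin 2 → ZMod p) →ₗ[ZMod p] ZMod p :=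
  v 0 • LinearMap.proj 1 - v 1 • LinearMap.proj 0

theorem crossForm_apply (p : ℕ) (v m : Fin 2 → ZMod p) :
    crossForm p v m = v 0 * m 1 - v 1 * m 0 := rfl

theorem crossForm_mulVec (p : ℕ) (g : Matrix (Fin 2) (Fin 2) (ZMod p)) (v m : Fin 2 → ZMod p) :
    crossForm p (g.mulVec v) (g.mulVec m) = g.det * crossForm p v m := by
  simp only [crossForm_apply, Matrix.mulVec, dotProduct, Fin.sum_univ_two, Matrix.det_fin_two]
  ring

/-- The linear map sending a family `w` of linear forms indexed by the lines `l` to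
`∑ det (l, w_l) l ^ k`. -/
noncomputable def crossSum (p k : ℕ) [NeZero p] :
    (Option (ZMod p) → Fin 2 → ZMod p) →ₗ[ZMod p] MvPolynomial (Fin 2) (ZMod p) :=
  ∑ o, ((crossForm p (lineRep p o)).comp (LinearMap.proj o)).smulRight
    (linForm p (lineRep p o) ^ k)

theorem crossSum_apply (p k : ℕ) [NeZero p] (w : Option (ZMod p) → Fin 2 → ZMod p) :
    crossSum p k w = ∑ o, crossForm p (lineRep p o) (w o) • linForm p (lineRep p o) ^ k := by
  simp [crossSum]

/-- Every pair `(v, m)` is represented by a family supported on the line of `v`, uniformly in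
the exponents congruent to `a - 1`. -/
theorem exists_lineSum_eq {p : ℕ} [Fact p.Prime] {a : ℕ} (ha : 2 ≤ a) (v m : Fin 2 → ZMod p) :
    ∃ w : Option (ZMod p) → Fin 2 → ZMod p,
      (∀ k, 0 < k → k ≡ a - 1 [MOD p - 1] →
        lineSum p k w = linForm p v ^ k * linForm p m) ∧
      crossSum p (a - 2) w = crossForm p v m • linForm p v ^ (a - 2) := by
  classical
  obtain ⟨c, o, rfl⟩ := exists_eq_smul_lineRep v
  refine ⟨Pi.single o (c ^ (a - 1) • m), fun k hk hka => ?_, ?_⟩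
  · rw [lineSum_apply, Finset.sum_eq_single o]
    · rw [Pi.single_eq_same, map_smul, linForm_smul_pow,
        zmod_pow_eq_of_modEq hk (by omega) hka, smul_mul_assoc, mul_smul_comm]
    · intro b _ hb
      rw [Pi.single_eq_of_ne hb, map_zero, mul_zero]
    · simp
  · rw [crossSum_apply, Finset.sum_eq_single o]
    · rw [Pi.single_eq_same, linForm_smul_pow, smul_smul, map_smul]
      congr 1
      obtain ⟨b, rfl⟩ := Nat.exists_eq_add_of_le ha
      rw [show 2 + b - 1 = b + 1 by omega, show 2 + b - 2 = b by omega]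
      simp only [crossForm_apply, Pi.smul_apply, smul_eq_mul]
      ring
    · intro b _ hb
      rw [Pi.single_eq_of_ne hb, map_zero, zero_smul]
    · simp

theorem range_lineSum (p r a : ℕ) [Fact p.Prime] (ha : 2 ≤ a) (hr : 1 < r)
    (hmod : r - 1 ≡ a - 1 [MOD p - 1]) :
    LinearMap.range (lineSum p (r - 1)) = Xr1Sub p r := by
  apply le_antisymm
  · rintro _ ⟨w, rfl⟩
    rw [lineSum_apply]
    exact Submodule.sum_mem _ fun o _ => linForm_pow_mul_mem p r _ _
  · rw [Xr1Sub_eq_span, Submodule.span_le]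
    rintro _ ⟨⟨v, m⟩, rfl⟩
    obtain ⟨w, hw, -⟩ := exists_lineSum_eq (p := p) ha v m
    exact ⟨w, hw _ (by omega) hmod⟩

/-- The action of the unipotent matrix `(1 1; 0 1)` on families of linear forms. -/
def unipotentShift (p : ℕ) :
    (Option (ZMod p) → Fin 2 → ZMod p) →ₗ[ZMod p] (Option (ZMod p) → Fin 2 → ZMod p) :=
  LinearMap.pi fun o =>
    (Matrix.mulVecLin !![1, 1; 0, 1]).comp (LinearMap.proj (o.map (· - 1)))

theorem unipotentShift_apply (p : ℕ) (w : Option (ZMod p) → Fin 2 → ZMod p)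
    (o : Option (ZMod p)) :
    unipotentShift p w o = ![w (o.map (· - 1)) 0 + w (o.map (· - 1)) 1,
      w (o.map (· - 1)) 1] := by
  ext i
  fin_cases i <;> simp [unipotentShift, Matrix.mulVec, dotProduct, Fin.sum_univ_two]

theorem unipotentShift_pow_apply (p k : ℕ) (w : Option (ZMod p) → Fin 2 → ZMod p)
    (o : Option (ZMod p)) :
    (unipotentShift p ^ k) w o = ![w (o.map (· - (k : ZMod p))) 0 +
      k * w (o.map (· - (k : ZMod p))) 1, w (o.map (· - (k : ZMod p))) 1] := by
  induction k generalizing o with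
  | zero => ext i; cases o <;> fin_cases i <;> simp
  | succ k ih =>
    have h : (o.map (· - 1)).map (· - (k : ZMod p)) = o.map (· - ((k + 1 : ℕ) : ZMod p)) := by
      cases o with
      | none => rfl
      | some t => simp [sub_sub, add_comm]
    rw [pow_succ', Module.End.mul_apply, unipotentShift_apply, ih, h]
    ext i
    (fin_cases i <;> simp); ring

theorem unipotentShift_sub_one_pow (p : ℕ) [Fact p.Prime] : (unipotentShift p - 1) ^ p = 0 := by
  have : CharP (Module.End (ZMod p) (Option (ZMod p) → Fin 2 → ZMod p)) p :=
    charP_of_injective_algebraMap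
      (FaithfulSMul.algebraMap_injective (ZMod p) _) p
  rw [sub_pow_char_of_commute p (Commute.one_right _), one_pow, sub_eq_zero]
  refine LinearMap.ext fun w => funext fun o => ?_
  rw [unipotentShift_pow_apply]
  ext i
  cases o <;> fin_cases i <;> simp

theorem lineSum_unipotentShift (p k : ℕ) [NeZero p] (w : Option (ZMod p) → Fin 2 → ZMod p) :
    lineSum p k (unipotentShift p w) = matAct p !![1, 1; 0, 1] (lineSum p k w) := by
  rw [lineSum_apply, lineSum_apply, map_sum]
  refine (Fintype.sum_equiv (Equiv.optionCongr (Equiv.addRight (1 : ZMod p))) _ _ fun o => ?_).symm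
  rw [map_mul, map_pow, matAct_linForm, matAct_linForm]
  congr 3
  · cases o <;> ext i <;> fin_cases i <;>
      simp [lineRep, Matrix.mulVec, dotProduct, Fin.sum_univ_two]
  · cases o <;> simp

/-- A nonzero subspace stable under a unipotent operator contains a nonzero fixed vector. -/
theorem exists_fixed_of_isNilpotent {K V : Type*} [Field K] [AddCommGroup V] [Module K V]
    (T : Module.End K V) (hT : IsNilpotent (T - 1)) (S : Submodule K V)
    (hS : ∀ v ∈ S, T v ∈ S) (hne : S ≠ ⊥) : ∃ v ∈ S, v ≠ 0 ∧ T v = v := by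
  classical
  obtain ⟨w, hw, hw0⟩ := S.exists_mem_ne_zero_of_ne_bot hne
  have hex : ∃ k : ℕ, ((T - 1) ^ k : Module.End K V) w = 0 := hT.imp fun k hk => by rw [hk]; rfl
  have hpos : Nat.find hex ≠ 0 := fun h => hw0 (by simpa [h] using Nat.find_spec hex)
  obtain ⟨k, hk⟩ := Nat.exists_eq_succ_of_ne_zero hpos
  have hmem : ∀ j : ℕ, ((T - 1) ^ j : Module.End K V) w ∈ S := by
    intro j
    induction j with
    | zero => simpa
    | succ j ih => rw [pow_succ']; exact S.sub_mem (hS _ ih) ih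
  refine ⟨_, hmem k, Nat.find_min hex (by omega), ?_⟩
  have h := Nat.find_spec hex
  rw [hk, pow_succ'] at h
  exact sub_eq_zero.1 h

/-- Setting `Y = 1`. -/
noncomputable def dehomogenize (p : ℕ) :
    MvPolynomial (Fin 2) (ZMod p) →ₐ[ZMod p] Polynomial (ZMod p) :=
  aeval ![Polynomial.X, 1]

theorem dehomogenize_linForm (p : ℕ) (v : Fin 2 → ZMod p) :
    dehomogenize p (linForm p v) = Polynomial.C (v 0) * Polynomial.X + Polynomial.C (v 1) := by
  simp [dehomogenize, linForm_apply, algHom_C]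

theorem coeff_C_mul_X_add_one_pow {R : Type*} [CommRing R] (t : R) (m i : ℕ) :
    ((Polynomial.C t * Polynomial.X + 1) ^ m).coeff i = m.choose i * t ^ i := by
  have h : (Polynomial.C t * Polynomial.X + 1 : Polynomial R) ^ m =
      ((Polynomial.X + 1) ^ m).comp (Polynomial.C t * Polynomial.X) := by simp
  rw [h, Polynomial.comp_C_mul_X_coeff, Polynomial.coeff_X_add_one_pow]

theorem coeff_dehomogenize_lineSum {p : ℕ} [Fact p.Prime] (k i : ℕ) (x b c : ZMod p)
    (w : Option (ZMod p) → Fin 2 → ZMod p) (hn : w none = ![x, 0])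
    (hs : ∀ t, w (some t) = ![b + t * c, c]) :
    (dehomogenize p (lineSum p k w)).coeff (i + 1) =
      (if i = k then x else 0) + b * (k.choose i * ∑ t : ZMod p, t ^ i) +
        c * ((k + 1).choose (i + 1) * ∑ t : ZMod p, t ^ (i + 1)) := by
  have hD : dehomogenize p (lineSum p k w) =
      Polynomial.C x * Polynomial.X ^ (k + 1) + ∑ t : ZMod p,
        (Polynomial.C b * (Polynomial.C t * Polynomial.X + 1) ^ k * Polynomial.X +
          Polynomial.C c * (Polynomial.C t * Polynomial.X + 1) ^ (k + 1)) := by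
    rw [lineSum_apply, Fintype.sum_option, map_add, map_sum]
    congr 1
    · simp only [map_mul, map_pow, dehomogenize_linForm, hn, lineRep]
      simp
      ring
    · refine Finset.sum_congr rfl fun t _ => ?_
      simp only [map_mul, map_pow, dehomogenize_linForm, hs, lineRep]
      simp
      ring
  rw [hD, Polynomial.coeff_add, Polynomial.finsetSum_coeff]
  simp only [Polynomial.coeff_add, Polynomial.coeff_C_mul, Polynomial.coeff_mul_X, mul_assoc,
    coeff_C_mul_X_add_one_pow, Polynomial.coeff_X_pow, Finset.sum_add_distrib, ← Finset.mul_sum]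
  simp only [add_left_inj, mul_ite, mul_one, mul_zero, add_assoc]

/-- The products `l ^ (r - 1) * m`, with `l` running over the lines and `m` over a basis of the
linear forms, are linearly independent. -/
theorem lineSum_injective {p r a : ℕ} [hp : Fact p.Prime] (hr : 1 < r) (ha : 2 ≤ a)
    (ha2 : a ≤ p - 1) (hmod : r ≡ a [MOD p - 1])
    (h1 : ∃ j, 0 < j ∧ p - 1 ∣ j ∧ ¬ p ∣ (r - 1).choose j)
    (h2 : ∃ j, 0 < j ∧ j ≠ r ∧ p - 1 ∣ j ∧ ¬ p ∣ r.choose j) :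
    Function.Injective (lineSum p (r - 1)) := by
  rw [← LinearMap.ker_eq_bot]
  by_contra hne
  obtain ⟨w, hwK, hw0, hw⟩ := exists_fixed_of_isNilpotent (unipotentShift p)
    ⟨p, unipotentShift_sub_one_pow p⟩ _ (fun v hv => by
      rw [LinearMap.mem_ker] at hv ⊢
      rw [lineSum_unipotentShift, hv, map_zero]) hne
  have hpow : ∀ t : ZMod p, (unipotentShift p ^ t.val) w = w := fun t => by
    rw [Module.End.pow_apply]
    exact Function.iterate_fixed hw _
  have hn : w none = ![w none 0, 0] := by
    have h := congrFun (congrFun hw none) 0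
    rw [unipotentShift_apply] at h
    ext i
    fin_cases i
    · rfl
    · simpa using h
  have hs : ∀ t, w (some t) = ![w (some 0) 0 + t * w (some 0) 1, w (some 0) 1] := fun t => by
    have h := congrFun (hpow t) (some t)
    rw [unipotentShift_pow_apply] at h
    simpa using h.symm
  have hc : ∀ i, (if i = r - 1 then w none 0 else 0) +
      w (some 0) 0 * ((r - 1).choose i * ∑ t : ZMod p, t ^ i) +
        w (some 0) 1 * (r.choose (i + 1) * ∑ t : ZMod p, t ^ (i + 1)) = 0 := fun i => by
    have h := coeff_dehomogenize_lineSum (r - 1) i _ _ _ w hn hs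
    rw [LinearMap.mem_ker.1 hwK, map_zero, Polynomial.coeff_zero,
      Nat.sub_add_cancel hr.le] at h
    exact h.symm
  have hb : w (some 0) 0 = 0 := by
    obtain ⟨j, hj0, hj, hd⟩ := h1
    have h := hc j
    have hne : j ≠ r - 1 := by
      rintro rfl
      have h3 : r - 1 ≡ a - 1 [MOD p - 1] := by
        refine Nat.ModEq.add_right_cancel' 1 ?_
        rwa [Nat.sub_add_cancel hr.le, Nat.sub_add_cancel (by omega)]
      have := Nat.le_of_dvd (by omega) ((h3.dvd_iff dvd_rfl).1 hj)
      omega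
    have hnd : ¬ p - 1 ∣ j + 1 := fun h => by
      have := Nat.le_of_dvd one_pos ((Nat.dvd_add_right hj).1 h)
      omega
    rw [if_neg hne, sum_zmod_pow hj0, if_pos hj, sum_zmod_pow j.succ_pos, if_neg hnd] at h
    have hd' : ((r - 1).choose j : ZMod p) ≠ 0 := by
      rwa [Ne, ZMod.natCast_eq_zero_iff]
    simpa [hd'] using h
  have hc0 : w (some 0) 1 = 0 := by
    obtain ⟨j, hj0, hjr, hj, hd⟩ := h2
    obtain ⟨i, rfl⟩ := Nat.exists_eq_succ_of_ne_zero hj0.ne'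
    have h := hc i
    have hd' : (r.choose (i + 1) : ZMod p) ≠ 0 := by
      rwa [Ne, ZMod.natCast_eq_zero_iff]
    rw [if_neg (by omega), hb, sum_zmod_pow i.succ_pos, if_pos hj] at h
    simpa [hd'] using h
  have hx : w none 0 = 0 := by simpa [hb, hc0] using hc (r - 1)
  refine hw0 (funext fun o => ?_)
  cases o with
  | none => rw [hn, hx]; ext i; fin_cases i <;> rfl
  | some t => rw [hs, hb, hc0]; ext i; fin_cases i <;> simp

theorem Vh_eq_span (p m : ℕ) : Vh p m = Submodule.span (ZMod p)
    (Set.range fun i : Fin (m + 1) =>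
      (X 0 ^ (i : ℕ) * X 1 ^ (m - i) : MvPolynomial (Fin 2) (ZMod p))) := by
  rw [Vh, homogeneousSubmodule_eq_finsupp_supported, AddMonoidAlgebra.supported_eq_span_single]
  congr 1
  ext F
  constructor
  · rintro ⟨d, hd, rfl⟩
    rw [Set.mem_ofPred_eq, Finsupp.degree_eq_sum, Fin.sum_univ_two] at hd
    refine ⟨⟨d 0, by omega⟩, ?_⟩
    change _ = monomial d 1
    rw [monomial_eq, Finsupp.prod_fintype _ _ (by simp), Fin.prod_univ_two, C_1, one_mul,
      show d 1 = m - d 0 by omega]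
  · rintro ⟨i, rfl⟩
    refine ⟨Finsupp.single 0 (i : ℕ) + Finsupp.single 1 (m - i), ?_, ?_⟩
    · have := i.is_lt
      rw [Set.mem_ofPred_eq, map_add, Finsupp.degree_single, Finsupp.degree_single]
      omega
    · change monomial _ 1 = X 0 ^ (i : ℕ) * X 1 ^ (m - (i : ℕ))
      rw [X_pow_eq_monomial, X_pow_eq_monomial, monomial_mul, one_mul]

theorem finrank_Vh (p m : ℕ) [Fact p.Prime] : Module.finrank (ZMod p) ↥(Vh p m) = m + 1 := by
  rw [Vh_eq_span, finrank_span_eq_card, Fintype.card_fin]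
  have h := (basisMonomials (Fin 2) (ZMod p)).linearIndependent.comp
    (fun i : Fin (m + 1) => Finsupp.single 0 (i : ℕ) + Finsupp.single 1 (m - i)) (by
      intro i j hij
      have := DFunLike.congr_fun hij 0
      exact Fin.ext (by simpa using this))
  have he : (basisMonomials (Fin 2) (ZMod p)) ∘
      (fun i : Fin (m + 1) => Finsupp.single 0 (i : ℕ) + Finsupp.single 1 (m - i)) =
      fun i : Fin (m + 1) => X 0 ^ (i : ℕ) * X 1 ^ (m - i) := funext fun i => by
    rw [Function.comp_apply, coe_basisMonomials, X_pow_eq_monomial, X_pow_eq_monomial,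
      monomial_mul, one_mul]
  rw [he] at h
  exact h

instance (p m : ℕ) [Fact p.Prime] : FiniteDimensional (ZMod p) ↥(Vh p m) :=
  Module.finite_of_finrank_pos (by rw [finrank_Vh]; omega)

theorem isHomogeneous_matAct {p m : ℕ} (g : Matrix (Fin 2) (Fin 2) (ZMod p))
    {F : MvPolynomial (Fin 2) (ZMod p)} (hF : F.IsHomogeneous m) :
    (matAct p g F).IsHomogeneous m := by
  rw [← one_mul m]
  exact hF.aeval _ fun i => IsHomogeneous.sum _ _ _ fun j _ => isHomogeneous_C_mul_X _ _

theorem eval_matAct (p : ℕ) (g : Matrix (Fin 2) (Fin 2) (ZMod p)) (v : Fin 2 → ZMod p)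
    (F : MvPolynomial (Fin 2) (ZMod p)) :
    eval v (matAct p g F) = eval (g.transpose.mulVec v) F := by
  induction F using MvPolynomial.induction_on with
  | C a => simp [matAct]
  | add F G hF hG => simp only [map_add, hF, hG]
  | mul_X F i hF =>
    rw [map_mul, map_mul, hF, map_mul, matAct_X, linForm_apply]
    fin_cases i <;> simp

theorem pderiv_matAct (p : ℕ) (g : Matrix (Fin 2) (Fin 2) (ZMod p)) (i : Fin 2)
    (F : MvPolynomial (Fin 2) (ZMod p)) :
    pderiv i (matAct p g F) = ∑ j, C (g i j) * matAct p g (pderiv j F) := by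
  induction F using MvPolynomial.induction_on with
  | C a => simp [matAct]
  | add F G hF hG => simp only [map_add, hF, hG, mul_add, Finset.sum_add_distrib]
  | mul_X F k hF =>
    rw [map_mul, pderiv_mul, hF, matAct_X, linForm_apply]
    simp only [Fin.sum_univ_two, pderiv_mul, map_add, map_mul, matAct_X,
      linForm_apply, Matrix.col_apply]
    fin_cases i <;> fin_cases k <;>
      simp [pderiv_X] <;> ring

theorem eval_smul_of_isHomogeneous {R σ : Type*} [CommSemiring R] [Fintype σ] {m : ℕ}
    {F : MvPolynomial σ R} (hF : F.IsHomogeneous m) (c : R) (v : σ → R) :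
    eval (c • v) F = c ^ m * eval v F := by
  rw [eval_eq', eval_eq', Finset.mul_sum]
  refine Finset.sum_congr rfl fun d hd => ?_
  have hdeg : ∑ i, d i = m := by
    rw [← Finsupp.degree_eq_sum]
    by_contra h
    exact mem_support_iff.1 hd (hF.coeff_eq_zero h)
  simp only [Pi.smul_apply, smul_eq_mul, mul_pow, Finset.prod_mul_distrib,
    Finset.prod_pow_eq_pow_sum, hdeg]
  ring

theorem sum_eval_eq_zero_of_isHomogeneous {p m : ℕ} [Fact p.Prime]
    {F : MvPolynomial (Fin 2) (ZMod p)} (hF : F.IsHomogeneous m) (hm : m < 2 * (p - 1)) :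
    ∑ v, eval v F = 0 := by
  refine MvPolynomial.sum_eval_eq_zero F (hF.totalDegree_le.trans_lt ?_)
  rwa [ZMod.card, Fintype.card_fin, mul_comm]

theorem sum_eval_smul_linForm_pow {p m b : ℕ} [Fact p.Prime]
    {F : MvPolynomial (Fin 2) (ZMod p)} (hF : F.IsHomogeneous m) (hm : m + b < 2 * (p - 1)) :
    ∑ v, eval v F • linForm p v ^ b = 0 := by
  simp only [linForm_apply, add_pow, Finset.smul_sum]
  rw [Finset.sum_comm]
  refine Finset.sum_eq_zero fun i hi => ?_
  have hi' : i ≤ b := Nat.lt_succ_iff.1 (Finset.mem_range.1 hi)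
  have h : ∀ v : Fin 2 → ZMod p,
      eval v F • ((C (v 0) * X 0) ^ i * (C (v 1) * X 1) ^ (b - i) *
        (b.choose i : MvPolynomial (Fin 2) (ZMod p))) =
      eval v (F * (X 0 ^ i * X 1 ^ (b - i))) •
        (X 0 ^ i * X 1 ^ (b - i) * (b.choose i : MvPolynomial (Fin 2) (ZMod p))) := fun v => by
    simp only [smul_eq_C_mul, map_mul, map_pow, eval_X]
    ring
  have hhom : (F * (X 0 ^ i * X 1 ^ (b - i))).IsHomogeneous (m + (i + (b - i))) :=
    hF.mul ((isHomogeneous_X_pow _ _).mul (isHomogeneous_X_pow _ _))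
  rw [Finset.sum_congr rfl fun v _ => h v, ← Finset.sum_smul,
    sum_eval_eq_zero_of_isHomogeneous hhom (by omega), zero_smul]

/-- Summing a function that is constant along punctured lines. -/
theorem sum_eq_neg_sum_lineRep {p : ℕ} [Fact p.Prime] {A : Type*} [AddCommGroup A]
    [Module (ZMod p) A] (F : (Fin 2 → ZMod p) → A) (h0 : F 0 = 0)
    (hF : ∀ c : ZMod p, c ≠ 0 → ∀ v, F (c • v) = F v) :
    ∑ v, F v = -∑ o, F (lineRep p o) := by
  classical
  have key : ∀ x : A, ∑ _c ∈ (Finset.univ : Finset (ZMod p)).erase 0, x = -x := fun x => by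
    rw [Finset.sum_const, Finset.card_erase_of_mem (Finset.mem_univ _), Finset.card_univ,
      ZMod.card, ← Nat.cast_smul_eq_nsmul (ZMod p), Nat.cast_sub (Fact.out : p.Prime).one_le,
      CharP.cast_eq_zero, zero_sub, Nat.cast_one, neg_smul, one_smul]
  have h1 : ∑ x : ZMod p, F ![x, 0] = -F ![1, 0] := by
    rw [← Finset.add_sum_erase _ _ (Finset.mem_univ (0 : ZMod p)),
      show (![0, 0] : Fin 2 → ZMod p) = 0 by ext i; fin_cases i <;> rfl, h0, zero_add, ← key]
    refine Finset.sum_congr rfl fun x hx => ?_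
    rw [← hF x (Finset.ne_of_mem_erase hx) ![1, 0]]
    congr 1
    ext i
    fin_cases i <;> simp
  have h2 : ∀ y ∈ (Finset.univ : Finset (ZMod p)).erase 0,
      ∑ x : ZMod p, F ![x, y] = ∑ t : ZMod p, F ![t, 1] := fun y hy => by
    have hy0 := Finset.ne_of_mem_erase hy
    refine (Fintype.sum_equiv (Equiv.mulLeft₀ y hy0) _ _ fun t => ?_).symm
    rw [← hF y hy0]
    congr 1
    ext i
    fin_cases i <;> simp
  calc ∑ v, F v = ∑ q : ZMod p × ZMod p, F ![q.1, q.2] :=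
        Fintype.sum_equiv (finTwoArrowEquiv (ZMod p)) _ _ fun v => by
          congr 1
          ext i
          fin_cases i <;> rfl
    _ = ∑ y : ZMod p, ∑ x : ZMod p, F ![x, y] := by rw [Fintype.sum_prod_type_right]
    _ = -F ![1, 0] + -∑ t : ZMod p, F ![t, 1] := by
        rw [← Finset.add_sum_erase _ _ (Finset.mem_univ (0 : ZMod p)), h1,
          Finset.sum_congr rfl h2, key]
    _ = _ := by
        rw [Fintype.sum_option, neg_add]
        rfl

/-- In degrees at most `p - 1`, the powers of linear forms span `V_b`. -/
theorem Vh_le_span_linForm_pow {p b : ℕ} [hp : Fact p.Prime] (hb : b ≤ p - 1) :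
    Vh p b ≤ Submodule.span (ZMod p)
      (Set.range fun o => linForm p (lineRep p o) ^ b) := by
  rw [Vh_eq_span, Submodule.span_le]
  rintro _ ⟨⟨i, hi⟩, rfl⟩
  have hi' : i ≤ b := by omega
  have hp2 := hp.out.two_le
  rcases Nat.eq_zero_or_pos i with rfl | hi0
  · exact Submodule.subset_span ⟨some 0, by simp [lineRep, linForm_apply]⟩
  have hsum : ∑ t : ZMod p, t ^ (p - 1 - i) • linForm p (lineRep p (some t)) ^ b =
      -(b.choose i : ZMod p) • (X 0 ^ i * X 1 ^ (b - i) : MvPolynomial (Fin 2) (ZMod p)) := by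
    have h : ∀ t : ZMod p, t ^ (p - 1 - i) • linForm p (lineRep p (some t)) ^ b =
        ∑ k ∈ Finset.range (b + 1), t ^ (p - 1 - i + k) • ((b.choose k : ZMod p) •
          (X 0 ^ k * X 1 ^ (b - k) : MvPolynomial (Fin 2) (ZMod p))) := fun t => by
      simp only [linForm_apply, lineRep, add_pow, Finset.smul_sum]
      refine Finset.sum_congr rfl fun k _ => ?_
      simp only [smul_eq_C_mul, map_pow, map_natCast]
      simp
      ring
    rw [Finset.sum_congr rfl fun t _ => h t, Finset.sum_comm]
    simp only [← Finset.sum_smul]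
    rw [Finset.sum_eq_single_of_mem i (Finset.mem_range.2 (by omega))]
    · rw [Nat.sub_add_cancel (by omega), sum_zmod_pow (by omega), if_pos dvd_rfl, neg_smul,
        neg_smul, one_smul]
    · intro k hk hki
      have hk' := Finset.mem_range.1 hk
      rcases Nat.eq_zero_or_pos (p - 1 - i + k) with h0 | h0
      · simp [h0]
      · rw [sum_zmod_pow h0, if_neg, zero_smul]
        rintro ⟨c, hc⟩
        rcases c with _ | _ | c
        · omega
        · omega
        · rw [mul_add, mul_add, mul_one] at hc
          have := Nat.zero_le ((p - 1) * c)
          omega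
  have hch : (b.choose i : ZMod p) ≠ 0 := by
    rw [Ne, ZMod.natCast_eq_zero_iff]
    intro hdvd
    have h1 := hp.out.dvd_factorial.1 (hdvd.trans
      ⟨_, ((mul_assoc _ _ _).symm.trans (Nat.choose_mul_factorial_mul_factorial hi')).symm⟩)
    omega
  refine (Submodule.smul_mem_iff _ (neg_ne_zero.2 hch)).1 ?_
  change -(b.choose i : ZMod p) • (X 0 ^ i * X 1 ^ (b - i)) ∈ Submodule.span _ _
  rw [← hsum]
  exact Submodule.sum_mem _ fun t _ =>
    Submodule.smul_mem _ _ (Submodule.subset_span ⟨some t, rfl⟩)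

/-- The linear map sending a pair `M` of polynomial functions on `F_p²`, viewed as a function
with values in linear forms, to `∑ l ^ k * M l` over all linear forms `l`. -/
noncomputable def vecSum (p k : ℕ) [NeZero p] :
    (Fin 2 → MvPolynomial (Fin 2) (ZMod p)) →ₗ[ZMod p] MvPolynomial (Fin 2) (ZMod p) where
  toFun M := ∑ v, linForm p v ^ k * linForm p fun i => eval v (M i)
  map_add' M N := by
    rw [← Finset.sum_add_distrib]
    refine Finset.sum_congr rfl fun v _ => ?_
    rw [← mul_add, ← map_add]
    congr 2
    ext i
    simp
  map_smul' c M := by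
    rw [RingHom.id_apply, Finset.smul_sum]
    refine Finset.sum_congr rfl fun v _ => ?_
    rw [← mul_smul_comm, ← map_smul]
    congr 2
    ext i
    simp

theorem vecSum_apply (p k : ℕ) [NeZero p] (M : Fin 2 → MvPolynomial (Fin 2) (ZMod p)) :
    vecSum p k M = ∑ v, linForm p v ^ k * linForm p fun i => eval v (M i) := rfl

/-- The substitution `X ↦ Y`, `Y ↦ -X`. -/
noncomputable def quarterTurn (p : ℕ) :
    MvPolynomial (Fin 2) (ZMod p) →ₐ[ZMod p] MvPolynomial (Fin 2) (ZMod p) :=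
  matAct p !![0, -1; 1, 0]

theorem quarterTurn_X_zero (p : ℕ) : quarterTurn p (X 0) = X 1 := by
  simp [quarterTurn, matAct_X, linForm_apply]

theorem quarterTurn_X_one (p : ℕ) : quarterTurn p (X 1) = -X 0 := by
  simp [quarterTurn, matAct_X, linForm_apply]

theorem eval_quarterTurn (p : ℕ) (v : Fin 2 → ZMod p) (F : MvPolynomial (Fin 2) (ZMod p)) :
    eval v (quarterTurn p F) = eval ![v 1, -v 0] F := by
  rw [quarterTurn, eval_matAct]
  congr 2
  ext i
  fin_cases i <;> simp [Matrix.mulVec, dotProduct, Fin.sum_univ_two]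

theorem quarterTurn_injective (p : ℕ) : Function.Injective (quarterTurn p) := by
  have h : (matAct p !![0, 1; -1, 0]).comp (quarterTurn p) = AlgHom.id _ _ := by
    ext1 i
    fin_cases i <;>
      simp [quarterTurn_X_zero, quarterTurn_X_one, matAct_X, linForm_apply]
  refine Function.LeftInverse.injective (g := matAct p !![0, 1; -1, 0]) fun F => ?_
  rw [← AlgHom.comp_apply, h, AlgHom.id_apply]

/-- The pair of polynomial functions `v ↦ P (J v) v + (∇ Q) (J v)`, where `J` is the
quarter turn. -/
noncomputable def embedPair (p : ℕ) :
    MvPolynomial (Fin 2) (ZMod p) × MvPolynomial (Fin 2) (ZMod p) →ₗ[ZMod p]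
      (Fin 2 → MvPolynomial (Fin 2) (ZMod p)) :=
  LinearMap.pi fun i =>
    ((LinearMap.mulRight (ZMod p) (X i)).comp (quarterTurn p).toLinearMap).coprod
      ((quarterTurn p).toLinearMap.comp (pderiv i).toLinearMap)

theorem embedPair_apply (p : ℕ) (P Q : MvPolynomial (Fin 2) (ZMod p)) (i : Fin 2) :
    embedPair p (P, Q) i = quarterTurn p P * X i + quarterTurn p (pderiv i Q) := rfl

theorem isHomogeneous_embedPair {p d : ℕ} {P Q : MvPolynomial (Fin 2) (ZMod p)}
    (hP : P.IsHomogeneous d) (hQ : Q.IsHomogeneous (d + 2)) (i : Fin 2) :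
    (embedPair p (P, Q) i).IsHomogeneous (d + 1) :=
  ((isHomogeneous_matAct _ hP).mul (isHomogeneous_X _ _)).add (isHomogeneous_matAct _ hQ.pderiv)

theorem embedPair_eq_zero {p d : ℕ} [Fact p.Prime] {P Q : MvPolynomial (Fin 2) (ZMod p)}
    (hQ : Q.IsHomogeneous (d + 2)) (hd : d + 2 < p) (h : embedPair p (P, Q) = 0) :
    P = 0 ∧ Q = 0 := by
  have h0 := congrFun h 0
  have h1 := congrFun h 1
  rw [embedPair_apply, Pi.zero_apply] at h0 h1
  have hQ0 : Q = 0 := by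
    have he := hQ.sum_X_mul_pderiv
    rw [Fin.sum_univ_two] at he
    have hz : quarterTurn p (X 0 * pderiv 0 Q + X 1 * pderiv 1 Q) = 0 := by
      rw [map_add, map_mul, map_mul, quarterTurn_X_zero, quarterTurn_X_one]
      linear_combination X 1 * h0 - X 0 * h1
    rw [← map_zero (quarterTurn p)] at hz
    have hn := he.symm.trans (quarterTurn_injective p hz)
    rw [← Nat.cast_smul_eq_nsmul (ZMod p)] at hn
    refine (smul_eq_zero.1 hn).resolve_left ?_
    rw [ZMod.natCast_eq_zero_iff]
    exact fun hdvd => absurd (Nat.le_of_dvd (by omega) hdvd) (by omega)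
  refine ⟨?_, hQ0⟩
  rw [hQ0, map_zero, map_zero, add_zero] at h0
  have hP := (mul_eq_zero.1 h0).resolve_right (X_ne_zero 0)
  exact quarterTurn_injective p (hP.trans (map_zero _).symm)

theorem vecSum_injOn {p k d : ℕ} [Fact p.Prime] (hk : 0 < k) (hdp : d ≤ p)
    (hkd : p - 1 ∣ k + d) (hinj : Function.Injective (lineSum p k))
    {M : Fin 2 → MvPolynomial (Fin 2) (ZMod p)} (hM : ∀ i, (M i).IsHomogeneous d)
    (h : vecSum p k M = 0) : M = 0 := by
  have hsmul : ∀ (c : ZMod p) (v : Fin 2 → ZMod p),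
      (fun i => eval (c • v) (M i)) = c ^ d • fun i => eval v (M i) := fun c v =>
    funext fun i => eval_smul_of_isHomogeneous (hM i) c v
  rw [vecSum_apply, sum_eq_neg_sum_lineRep, neg_eq_zero,
    ← lineSum_apply p k fun o i => eval (lineRep p o) (M i)] at h
  · have h0 := hinj (h.trans (map_zero _).symm)
    funext i
    refine (hM i).eq_zero_of_forall_eval_eq_zero_of_le_card (fun v => ?_) ?_
    · obtain ⟨c, o, rfl⟩ := exists_eq_smul_lineRep v
      rw [eval_smul_of_isHomogeneous (hM i), congrFun (congrFun h0 o) i]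
      simp
    · rw [Cardinal.mk_fintype, ZMod.card]
      exact_mod_cast hdp
  · rw [map_zero, zero_pow hk.ne', zero_mul]
  · intro c hc v
    rw [hsmul, linForm_smul_pow, map_smul, smul_mul_smul_comm, ← pow_add]
    obtain ⟨e, he⟩ := hkd
    rw [he, pow_mul, ZMod.pow_card_sub_one_eq_one hc, one_pow, one_smul]

theorem exists_mulVec_eq_smul {K : Type*} [Field K] (g : Matrix (Fin 2) (Fin 2) K)
    (hg : g.det = 0) : ∃ α e : Fin 2 → K, ∀ v, g.mulVec v = (α 0 * v 0 + α 1 * v 1) • e := by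
  rw [Matrix.det_fin_two] at hg
  by_cases h : g.col 0 = 0
  · refine ⟨![0, 1], g.col 1, fun v => funext fun i => ?_⟩
    have := congrFun h i
    simp only [Matrix.col_apply, Pi.zero_apply] at this
    simp [Matrix.mulVec, dotProduct, Fin.sum_univ_two, this, mul_comm]
  · obtain ⟨k, hk⟩ := Function.ne_iff.1 h
    rw [Matrix.col_apply, Pi.zero_apply] at hk
    refine ⟨![1, g k 1 / g k 0], g.col 0, fun v => funext fun i => ?_⟩
    have hi : g i 1 * g k 0 = g k 1 * g i 0 := by
      fin_cases i <;> fin_cases k <;> simp <;>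
        first | linear_combination hg | linear_combination -hg
    simp only [Matrix.mulVec, dotProduct, Fin.sum_univ_two, Matrix.col_apply, Pi.smul_apply,
      smul_eq_mul, Matrix.cons_val_zero, Matrix.cons_val_one]
    field_simp
    linear_combination v 1 * hi

theorem matAct_vecSum_of_det_eq_zero {p k b d : ℕ} [Fact p.Prime] (hk : 0 < k) (hb : 0 < b)
    (hkb : k ≡ b [MOD p - 1]) (hbd : b + d < 2 * (p - 1))
    {M : Fin 2 → MvPolynomial (Fin 2) (ZMod p)} (hM : ∀ i, (M i).IsHomogeneous d)
    (g : Matrix (Fin 2) (Fin 2) (ZMod p)) (hg : g.det = 0) :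
    matAct p g (vecSum p k M) = 0 := by
  obtain ⟨α, e, he⟩ := exists_mulVec_eq_smul g hg
  rw [vecSum_apply, map_sum]
  have hterm : ∀ v, matAct p g (linForm p v ^ k * linForm p fun i => eval v (M i)) =
      ∑ i, eval v (linForm p α ^ b * M i) • (linForm p e ^ k * linForm p (g.col i)) := fun v => by
    rw [map_mul, map_pow, matAct_linForm, he, linForm_smul_pow, zmod_pow_eq_of_modEq hk hb hkb,
      linForm_apply p (fun i => eval v (M i)), map_add, map_mul, map_mul, matAct_X, matAct_X]
    simp only [algHom_C, algebraMap_eq, Fin.sum_univ_two, smul_eq_C_mul, map_mul, map_pow,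
      linForm_apply p α, map_add, eval_C, eval_X]
    ring
  rw [Finset.sum_congr rfl fun v _ => hterm v, Finset.sum_comm]
  refine Finset.sum_eq_zero fun i _ => ?_
  have hhom : (linForm p α ^ b * M i).IsHomogeneous (1 * b + d) :=
    ((isHomogeneous_linForm p α).pow b).mul (hM i)
  rw [← Finset.sum_smul, sum_eval_eq_zero_of_isHomogeneous hhom (by omega), zero_smul]

theorem eval_quarterTurn_matAct {p m : ℕ} (g : Matrix (Fin 2) (Fin 2) (ZMod p))
    {F : MvPolynomial (Fin 2) (ZMod p)} (hF : F.IsHomogeneous m) (v : Fin 2 → ZMod p) :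
    eval (g.mulVec v) (quarterTurn p (matAct p g F)) =
      g.det ^ m * eval v (quarterTurn p F) := by
  rw [eval_quarterTurn, eval_quarterTurn, eval_matAct, ← eval_smul_of_isHomogeneous hF]
  congr 2
  ext i
  fin_cases i <;>
    simp [Matrix.mulVec, dotProduct, Fin.sum_univ_two, Matrix.det_fin_two] <;> ring

theorem matAct_vecSum_embedPair {p k a d : ℕ} [Fact p.Prime] (hk : 0 < k) (ha : 2 ≤ a)
    (hda : a + d + 1 = p) (hka : k ≡ a - 1 [MOD p - 1])
    {P Q : MvPolynomial (Fin 2) (ZMod p)}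
    (hP : P.IsHomogeneous d) (hQ : Q.IsHomogeneous (d + 2))
    (g : Matrix (Fin 2) (Fin 2) (ZMod p)) :
    matAct p g (vecSum p k (embedPair p (P, Q))) =
      vecSum p k (embedPair p (g.det ^ a • matAct p g P, g.det ^ (a - 1) • matAct p g Q)) := by
  rcases eq_or_ne g.det 0 with hg | hg
  · rw [matAct_vecSum_of_det_eq_zero hk (by omega) hka (by omega)
      (isHomogeneous_embedPair hP hQ) g hg, hg, zero_pow (by omega), zero_pow (by omega),
      zero_smul, zero_smul, ← Prod.zero_eq_mk, map_zero, map_zero]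
  · have hunit : IsUnit g := (Matrix.isUnit_iff_isUnit_det g).2 (isUnit_iff_ne_zero.2 hg)
    have hbij : Function.Bijective g.mulVec :=
      ⟨Matrix.mulVec_injective_iff_isUnit.2 hunit, Matrix.mulVec_surjective_iff_isUnit.2 hunit⟩
    have hone : g.det ^ (p - 1) = 1 := ZMod.pow_card_sub_one_eq_one hg
    rw [vecSum_apply, vecSum_apply, map_sum]
    refine Eq.trans (Finset.sum_congr rfl fun v _ => ?_) (hbij.sum_comp _)
    rw [map_mul, map_pow, matAct_linForm, matAct_linForm]
    congr 2
    funext i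
    have h1 : g.det ^ a * g.det ^ d = 1 := by
      rw [← pow_add, ← hone]
      congr 1
      omega
    have h2 : g.det ^ (a - 1) * g.det ^ (d + 2 - 1) = 1 := by
      rw [← pow_add, ← hone]
      congr 1
      omega
    have hC : ∀ c : ZMod p, quarterTurn p (C c) = C c := fun c => algHom_C _ c
    simp only [embedPair_apply, smul_eq_C_mul, pderiv_C_mul, pderiv_matAct, map_add, map_mul,
      map_sum, hC, eval_C, eval_X, eval_quarterTurn_matAct g hP,
      eval_quarterTurn_matAct g hQ.pderiv]
    simp only [Matrix.mulVec, dotProduct, Fin.sum_univ_two]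
    linear_combination (-(eval v (quarterTurn p P)) * (g i 0 * v 0 + g i 1 * v 1)) * h1 -
      (g i 0 * eval v (quarterTurn p (pderiv 0 Q)) +
        g i 1 * eval v (quarterTurn p (pderiv 1 Q))) * h2

theorem exists_quotientMap {p r a : ℕ} [Fact p.Prime] (ha : 2 ≤ a) (hr : 1 < r)
    (hmod : r - 1 ≡ a - 1 [MOD p - 1]) (hinj : Function.Injective (lineSum p (r - 1))) :
    ∃ φ : MvPolynomial (Fin 2) (ZMod p) →ₗ[ZMod p]
        MvPolynomial (Fin 2) (ZMod p) × MvPolynomial (Fin 2) (ZMod p),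
      ∀ v m, φ (linForm p v ^ (r - 1) * linForm p m) =
        (crossForm p v m • linForm p v ^ (a - 2), linForm p v ^ (a - 1) * linForm p m) := by
  obtain ⟨s, hs⟩ := (lineSum p (r - 1)).exists_leftInverse_of_injective
    (LinearMap.ker_eq_bot.2 hinj)
  refine ⟨((crossSum p (a - 2)).prod (lineSum p (a - 1))).comp s, fun v m => ?_⟩
  obtain ⟨w, hw, hc⟩ := exists_lineSum_eq ha v m
  have hsw : s (lineSum p (r - 1) w) = w := LinearMap.congr_fun hs w
  rw [← hw (r - 1) (by omega) hmod, LinearMap.comp_apply, hsw]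
  exact Prod.ext hc (hw (a - 1) (by omega) rfl)

section QuotientMap

variable {p r a : ℕ}
  {φ : MvPolynomial (Fin 2) (ZMod p) →ₗ[ZMod p]
    MvPolynomial (Fin 2) (ZMod p) × MvPolynomial (Fin 2) (ZMod p)}

theorem quotientMap_mem
    (hφ : ∀ v m, φ (linForm p v ^ (r - 1) * linForm p m) =
      (crossForm p v m • linForm p v ^ (a - 2), linForm p v ^ (a - 1) * linForm p m))
    (ha : 2 ≤ a) {F : MvPolynomial (Fin 2) (ZMod p)} (hF : F ∈ Xr1Sub p r) :
    φ F ∈ (Vh p (a - 2)).prod (Vh p a) := by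
  suffices h : Xr1Sub p r ≤ ((Vh p (a - 2)).prod (Vh p a)).comap φ from h hF
  rw [Xr1Sub_eq_span, Submodule.span_le]
  rintro _ ⟨⟨v, m⟩, rfl⟩
  rw [SetLike.mem_coe, Submodule.mem_comap, hφ]
  have h1 : (linForm p v ^ (a - 2)).IsHomogeneous (1 * (a - 2)) :=
    (isHomogeneous_linForm p v).pow _
  have h2 : (linForm p v ^ (a - 1) * linForm p m).IsHomogeneous (1 * (a - 1) + 1) :=
    ((isHomogeneous_linForm p v).pow _).mul (isHomogeneous_linForm p m)
  rw [one_mul] at h1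
  rw [show 1 * (a - 1) + 1 = a by omega] at h2
  exact ⟨Submodule.smul_mem _ _ h1, h2⟩

theorem quotientMap_matAct
    (hφ : ∀ v m, φ (linForm p v ^ (r - 1) * linForm p m) =
      (crossForm p v m • linForm p v ^ (a - 2), linForm p v ^ (a - 1) * linForm p m))
    (g : Matrix (Fin 2) (Fin 2) (ZMod p))
    {F : MvPolynomial (Fin 2) (ZMod p)} (hF : F ∈ Xr1Sub p r) :
    φ (matAct p g F) = (g.det • matAct p g (φ F).1, matAct p g (φ F).2) := by
  rw [Xr1Sub_eq_span] at hF
  induction hF using Submodule.span_induction with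
  | mem x hx =>
    obtain ⟨⟨v, m⟩, rfl⟩ := hx
    simp only [map_mul, map_pow, matAct_linForm, hφ, crossForm_mulVec, map_smul, mul_smul]
  | zero => simp [Prod.zero_eq_mk]
  | add x y _ _ hx hy => rw [map_add, map_add, hx, hy, map_add]; simp
  | smul c x _ hx => rw [map_smul, map_smul, hx, map_smul]; simp [smul_comm c]

theorem prod_Vh_le_map_quotientMap [Fact p.Prime]
    (hφ : ∀ v m, φ (linForm p v ^ (r - 1) * linForm p m) =
      (crossForm p v m • linForm p v ^ (a - 2), linForm p v ^ (a - 1) * linForm p m))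
    (ha : 2 ≤ a) (ha2 : a ≤ p - 1) :
    (Vh p (a - 2)).prod (Vh p a) ≤ (Xr1Sub p r).map φ := by
  have h2 : Vh p a ≤ ((Xr1Sub p r).map φ).comap (LinearMap.inr (ZMod p) _ _) := by
    refine (Vh_le_span_linForm_pow ha2).trans (Submodule.span_le.2 ?_)
    rintro _ ⟨o, rfl⟩
    refine ⟨_, linForm_pow_mul_mem p r (lineRep p o) (lineRep p o), ?_⟩
    rw [hφ, ← pow_succ, show a - 1 + 1 = a by omega, crossForm_apply, mul_comm, sub_self,
      zero_smul, LinearMap.inr_apply]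
  have h1 : Vh p (a - 2) ≤ ((Xr1Sub p r).map φ).map (LinearMap.fst (ZMod p) _ _) := by
    refine (Vh_le_span_linForm_pow (by omega)).trans (Submodule.span_le.2 ?_)
    rintro _ ⟨o, rfl⟩
    obtain ⟨m, hm⟩ : ∃ m, crossForm p (lineRep p o) m = 1 := by
      cases o with
      | none => exact ⟨![0, 1], by simp [crossForm_apply, lineRep]⟩
      | some t => exact ⟨![-1, 0], by simp [crossForm_apply, lineRep]⟩
    refine ⟨_, ⟨_, linForm_pow_mul_mem p r (lineRep p o) m, rfl⟩, ?_⟩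
    rw [hφ, hm, one_smul, LinearMap.fst_apply]
  rintro ⟨A, B⟩ ⟨hA, hB⟩
  obtain ⟨_, ⟨F, hF, rfl⟩, rfl⟩ := h1 hA
  have hd := h2 (Submodule.sub_mem _ hB (quotientMap_mem hφ ha hF).2)
  rw [Submodule.mem_comap, LinearMap.inr_apply] at hd
  convert Submodule.add_mem _ (Submodule.mem_map_of_mem hF) hd using 1
  ext1 <;> simp

theorem quotientMap_vecSum_embedPair {d : ℕ} [Fact p.Prime]
    (hφ : ∀ v m, φ (linForm p v ^ (r - 1) * linForm p m) =
      (crossForm p v m • linForm p v ^ (a - 2), linForm p v ^ (a - 1) * linForm p m))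
    (ha : 2 ≤ a)
    (hda : a + d + 1 = p) {P Q : MvPolynomial (Fin 2) (ZMod p)}
    (hP : P.IsHomogeneous d) (hQ : Q.IsHomogeneous (d + 2)) :
    φ (vecSum p (r - 1) (embedPair p (P, Q))) = 0 := by
  set M := embedPair p (P, Q) with hM
  have hMh : ∀ i, (M i).IsHomogeneous (d + 1) := isHomogeneous_embedPair hP hQ
  rw [vecSum_apply, map_sum, Finset.sum_congr rfl fun v _ => hφ v _]
  ext1
  · have hN : (X 0 * M 1 - X 1 * M 0).IsHomogeneous (1 + (d + 1)) :=
      ((isHomogeneous_X _ _).mul (hMh 1)).sub ((isHomogeneous_X _ _).mul (hMh 0))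
    rw [Prod.fst_sum, Prod.fst_zero, ← sum_eval_smul_linForm_pow (b := a - 2) hN (by omega)]
    refine Finset.sum_congr rfl fun v _ => ?_
    simp [crossForm_apply]
  · have h := fun i => sum_eval_smul_linForm_pow (b := a - 1) (hMh i) (by omega)
    rw [Prod.snd_sum, Prod.snd_zero]
    calc ∑ v, linForm p v ^ (a - 1) * linForm p (fun i => eval v (M i))
        = ∑ v, ((eval v (M 0) • linForm p v ^ (a - 1)) * X 0 +
            (eval v (M 1) • linForm p v ^ (a - 1)) * X 1) := by
          refine Finset.sum_congr rfl fun v _ => ?_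
          rw [linForm_apply p fun i => eval v (M i), smul_eq_C_mul, smul_eq_C_mul]
          ring
      _ = 0 := by
          rw [Finset.sum_add_distrib, ← Finset.sum_mul, ← Finset.sum_mul, h, h, zero_mul,
            zero_mul, add_zero]

end QuotientMap

theorem finrank_Xr1Sub {p r a : ℕ} [Fact p.Prime] (ha : 2 ≤ a) (hr : 1 < r)
    (hmod : r - 1 ≡ a - 1 [MOD p - 1]) (hinj : Function.Injective (lineSum p (r - 1))) :
    Module.finrank (ZMod p) ↥(Xr1Sub p r) = 2 * p + 2 := by
  rw [← range_lineSum p r a ha hr hmod, LinearMap.finrank_range_of_inj hinj,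
    Module.finrank_pi_fintype]
  simp [ZMod.card]
  ring

/-- For a prime `p ≥ 3`, `r > 2p` with `r ≡ a mod (p−1)`, `2 ≤ a ≤ p−1`,
`r = p^n u` with `p ∤ u` and `Σ_p(u−1) > a − 1`, one has `dim X_{r−1} = 2p + 2` and
a short exact sequence of `M`-equivariant maps
`0 → (V_{p−a−1} ⊗ D^a) ⊕ (V_{p−a+1} ⊗ D^{a−1}) → X_{r−1} → (V_{a−2} ⊗ D) ⊕ V_a → 0`. -/
theorem Xr1_ses_big (p r a n u : ℕ) (hp : p.Prime) (hp3 : 3 ≤ p) (hr : 2 * p < r)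
    (ha : 2 ≤ a) (ha2 : a ≤ p - 1) (hmod : r ≡ a [MOD p - 1])
    (hru : r = p ^ n * u) (hu : ¬ p ∣ u)
    (hsig : a - 1 < (Nat.digits p (u - 1)).sum) :
    Module.finrank (ZMod p) ↥(Xr1Sub p r) = 2 * p + 2 ∧
    ∃ (ι : (↥(Vh p (p - a - 1)) × ↥(Vh p (p - a + 1))) →ₗ[ZMod p] ↥(Xr1Sub p r))
      (π : ↥(Xr1Sub p r) →ₗ[ZMod p] (↥(Vh p (a - 2)) × ↥(Vh p a))),
      Function.Injective ι ∧ Function.Surjective π ∧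
      LinearMap.ker π = LinearMap.range ι ∧
      EquivMap p a 0
        (ι.comp (LinearMap.inl (ZMod p) ↥(Vh p (p - a - 1)) ↥(Vh p (p - a + 1)))) ∧
      EquivMap p (a - 1) 0
        (ι.comp (LinearMap.inr (ZMod p) ↥(Vh p (p - a - 1)) ↥(Vh p (p - a + 1)))) ∧
      EquivMap p 0 1 ((LinearMap.fst (ZMod p) ↥(Vh p (a - 2)) ↥(Vh p a)).comp π) ∧
      EquivMap p 0 0 ((LinearMap.snd (ZMod p) ↥(Vh p (a - 2)) ↥(Vh p a)).comp π) := by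
  have := Fact.mk hp
  have hr1 : 1 < r := by omega
  have hmod1 : r - 1 ≡ a - 1 [MOD p - 1] := by
    apply Nat.ModEq.add_right_cancel' 1
    rwa [Nat.sub_add_cancel hr1.le, Nat.sub_add_cancel (by omega)]
  obtain ⟨h1, h2⟩ := exists_choose_of_digits_sum hp hp3 ha hmod hru hu hsig
  have hinj := lineSum_injective hr1 ha ha2 hmod h1 h2
  have hfin := finrank_Xr1Sub ha hr1 hmod1 hinj
  refine ⟨hfin, ?_⟩
  obtain ⟨φ, hφ⟩ := exists_quotientMap ha hr1 hmod1 hinj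
  obtain ⟨d, hd, hd2, hda⟩ : ∃ d, p - a - 1 = d ∧ p - a + 1 = d + 2 ∧ a + d + 1 = p :=
    ⟨p - a - 1, rfl, by omega, by omega⟩
  rw [hd, hd2]
  have hmem : ∀ M, vecSum p (r - 1) M ∈ Xr1Sub p r := fun M => by
    rw [vecSum_apply]
    exact Submodule.sum_mem _ fun v _ => linForm_pow_mul_mem p r v _
  let ι : (↥(Vh p d) × ↥(Vh p (d + 2))) →ₗ[ZMod p] ↥(Xr1Sub p r) :=
    (((vecSum p (r - 1)).comp (embedPair p)).comp
      ((Vh p d).subtype.prodMap (Vh p (d + 2)).subtype)).codRestrict _ fun _ => hmem _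
  have hι : ∀ x, (ι x : MvPolynomial (Fin 2) (ZMod p)) =
    vecSum p (r - 1) (embedPair p (x.1, x.2)) := fun _ => rfl
  let π : ↥(Xr1Sub p r) →ₗ[ZMod p] (↥(Vh p (a - 2)) × ↥(Vh p a)) :=
    (((LinearMap.fst (ZMod p) _ _).comp φ).restrict fun F hF =>
      (quotientMap_mem hφ ha hF).1).prod
    (((LinearMap.snd (ZMod p) _ _).comp φ).restrict fun F hF =>
      (quotientMap_mem hφ ha hF).2)
  have hπ1 : ∀ x, ((π x).1 : MvPolynomial (Fin 2) (ZMod p)) = (φ x).1 := fun _ => rfl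
  have hπ2 : ∀ x, ((π x).2 : MvPolynomial (Fin 2) (ZMod p)) = (φ x).2 := fun _ => rfl
  have hιinj : Function.Injective ι := by
    rw [injective_iff_map_eq_zero]
    rintro ⟨P, Q⟩ h
    have h0 : vecSum p (r - 1) (embedPair p (P, Q)) = 0 := congrArg Subtype.val h
    have hdvd : p - 1 ∣ r - 1 + (d + 1) := by
      rw [← Nat.modEq_zero_iff_dvd]
      refine (hmod1.add_right _).trans ?_
      rw [show a - 1 + (d + 1) = p - 1 by omega]
      exact Nat.modEq_zero_iff_dvd.2 dvd_rfl
    obtain ⟨hP, hQ⟩ := embedPair_eq_zero Q.2 (by omega)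
      (vecSum_injOn (by omega) (by omega) hdvd hinj (isHomogeneous_embedPair P.2 Q.2) h0)
    exact Prod.ext (Subtype.ext hP) (Subtype.ext hQ)
  have hπsurj : Function.Surjective π := fun y => by
    obtain ⟨F, hF, hFy⟩ := prod_Vh_le_map_quotientMap hφ ha ha2
      (show ((y.1 : MvPolynomial (Fin 2) (ZMod p)), (y.2 : MvPolynomial (Fin 2) (ZMod p))) ∈ _
        from ⟨y.1.2, y.2.2⟩)
    exact ⟨⟨F, hF⟩, Prod.ext (Subtype.ext (congrArg Prod.fst hFy))
      (Subtype.ext (congrArg Prod.snd hFy))⟩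
  have hfinite : FiniteDimensional (ZMod p) ↥(Xr1Sub p r) :=
    FiniteDimensional.of_finrank_pos (by omega)
  refine ⟨ι, π, hιinj, hπsurj, ?_, ?_, ?_, ?_, ?_⟩
  · symm
    refine Submodule.eq_of_le_of_finrank_eq ?_ ?_
    · rintro _ ⟨x, rfl⟩
      have h0 := quotientMap_vecSum_embedPair hφ ha hda x.1.2 x.2.2
      exact Prod.ext (Subtype.ext (congrArg Prod.fst h0)) (Subtype.ext (congrArg Prod.snd h0))
    · have hk := LinearMap.finrank_range_add_finrank_ker π
      rw [LinearMap.range_eq_top.2 hπsurj, finrank_top, Module.finrank_prod, finrank_Vh,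
        finrank_Vh, hfin] at hk
      rw [LinearMap.finrank_range_of_inj hιinj, Module.finrank_prod, finrank_Vh, finrank_Vh]
      omega
  · intro g x y hy
    have h := matAct_vecSum_embedPair (k := r - 1) (by omega) ha hda hmod1 x.2
      (isHomogeneous_zero _ _ _) g
    rw [map_zero, smul_zero] at h
    rw [LinearMap.comp_apply, LinearMap.comp_apply, hι, hι, twAct, pow_zero, one_smul]
    exact (congrArg (fun P => vecSum p (r - 1) (embedPair p (P, 0))) hy).trans h.symm
  · intro g x y hy
    have h := matAct_vecSum_embedPair (k := r - 1) (by omega) ha hda hmod1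
      (isHomogeneous_zero _ _ _) x.2 g
    rw [map_zero, smul_zero] at h
    rw [LinearMap.comp_apply, LinearMap.comp_apply, hι, hι, twAct, pow_zero, one_smul]
    exact (congrArg (fun Q => vecSum p (r - 1) (embedPair p (0, Q))) hy).trans h.symm
  · intro g x y hy
    rw [twAct, pow_zero, one_smul] at hy
    rw [LinearMap.comp_apply, LinearMap.comp_apply, LinearMap.fst_apply, LinearMap.fst_apply,
      hπ1, hπ1, hy, quotientMap_matAct hφ g x.2, twAct, pow_one]
  · intro g x y hy
    rw [twAct, pow_zero, one_smul] at hy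
    rw [LinearMap.comp_apply, LinearMap.comp_apply, LinearMap.snd_apply, LinearMap.snd_apply,
      hπ2, hπ2, hy, quotientMap_matAct hφ g x.2, twAct, pow_zero, one_smul]
end
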